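/- arXiv:1609.03891 — 3 statements merged into one kernel-verified Lean document; each statement's English description precedes it below -/
import Mathlib

section
/- The energy of the Archimedean path A = (A(t); 0 ≤ t ≤ 1) with respect to the 2-Wasserstein metric equals π²/6. -/
open MeasureTheory Set Filter
open scoped ENNReal Real Topology

/-- `t 0 = 0 < t 1 < ... < t k = 1` is a finite partition of [0,1]. -/
def IsPartition (k : ℕ) (t : ℕ → ℝ) : Prop :=
  0 < k ∧ t 0 = 0 ∧ t k = 1 ∧ ∀ i < k, t i < t (i + 1)

/-- The energy of a path along partitions of [0,1], expressed in terms of the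
squared-distance function `D s t` between the points `γ s` and `γ t` of the path:
`E = sup_Π Σ_i d(γ(t_i),γ(t_{i-1}))² / (t_i - t_{i-1})`. -/
noncomputable def energyOf (D : ℝ → ℝ → ℝ) : ℝ≥0∞ :=
  ⨆ (k : ℕ) (t : ℕ → ℝ) (_ : IsPartition k t),
    ENNReal.ofReal (∑ i ∈ Finset.range k, D (t i) (t (i + 1)) / (t (i + 1) - t i))

/-- Optimal transportation cost between two measures for the cost `c`. -/
noncomputable def W2sqCost {K : Type*} [MeasurableSpace K] (c : K × K → ℝ)
    (μ ν : Measure K) : ℝ :=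
  sInf {e | ∃ m : Measure (K × K), IsProbabilityMeasure m ∧
    m.map Prod.fst = μ ∧ m.map Prod.snd = ν ∧ e = ∫ p, c p ∂m}

/-- The squared 2-Wasserstein distance between measures on the plane,
with the Euclidean metric: `W₂(μ,ν)² = inf over couplings of E[‖V-W‖²]`. -/
noncomputable def W2sqE (μ ν : Measure (ℝ × ℝ)) : ℝ :=
  W2sqCost (fun p => (p.1.1 - p.2.1) ^ 2 + (p.1.2 - p.2.2) ^ 2) μ ν

/-- The Archimedean measure, with density (2π√(1-x²-y²))⁻¹ on the unit disk. -/
noncomputable def archMeasure : Measure (ℝ × ℝ) :=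
  volume.withDensity fun p =>
    ENNReal.ofReal
      (if p.1 ^ 2 + p.2 ^ 2 < 1 then (2 * π * Real.sqrt (1 - p.1 ^ 2 - p.2 ^ 2))⁻¹ else 0)

/-- The Archimedean path: `archPath t` is the law of (𝒜(0), 𝒜(t)) where
𝒜(t) = cos(πt)·Aₓ + sin(πt)·A_y with (Aₓ, A_y) distributed as the Archimedean measure. -/
noncomputable def archPath (t : ℝ) : Measure (ℝ × ℝ) :=
  archMeasure.map fun p => (p.1, Real.cos (π * t) * p.1 + Real.sin (π * t) * p.2)

/-- The radial profile of the density of `archMeasure`, as a function of the squared radius. -/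
noncomputable def archProfile (u : ℝ) : ℝ≥0∞ :=
  ENNReal.ofReal (if u < 1 then (2 * π * √(1 - u))⁻¹ else 0)

@[fun_prop]
lemma measurable_archProfile : Measurable archProfile :=
  (Measurable.ite measurableSet_Iio (by fun_prop) measurable_const).ennreal_ofReal

lemma archMeasure_eq_withDensity :
    archMeasure = volume.withDensity fun p => archProfile (p.1 ^ 2 + p.2 ^ 2) := by
  simp only [archMeasure, archProfile, sub_sub]

/-- The planar rotation by the angle `θ`. -/
noncomputable def planeRotation (θ : ℝ) : ℝ × ℝ →ₗ[ℝ] ℝ × ℝ :=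
  Matrix.toLin (Module.Basis.finTwoProd ℝ) (Module.Basis.finTwoProd ℝ)
    !![Real.cos θ, -Real.sin θ; Real.sin θ, Real.cos θ]

lemma planeRotation_apply (θ : ℝ) (p : ℝ × ℝ) :
    planeRotation θ p =
      (Real.cos θ * p.1 - Real.sin θ * p.2, Real.sin θ * p.1 + Real.cos θ * p.2) := by
  simp [planeRotation, Matrix.toLin_finTwoProd_apply, sub_eq_add_neg]

lemma measurable_planeRotation (θ : ℝ) : Measurable (planeRotation θ) :=
  (planeRotation θ).continuous_of_finiteDimensional.measurable

lemma map_planeRotation_volume (θ : ℝ) :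
    (volume : Measure (ℝ × ℝ)).map (planeRotation θ) = volume := by
  have hdet : LinearMap.det (planeRotation θ) = 1 := by
    rw [planeRotation, LinearMap.det_toLin, Matrix.det_fin_two_of]
    linear_combination Real.cos_sq_add_sin_sq θ
  rw [Measure.map_linearMap_addHaar_eq_smul_addHaar _ (by simp [hdet]), hdet]
  simp

lemma map_planeRotation_archMeasure (θ : ℝ) :
    archMeasure.map (planeRotation θ) = archMeasure := by
  have hm := measurable_planeRotation θ
  have hd : Measurable fun p : ℝ × ℝ => archProfile (p.1 ^ 2 + p.2 ^ 2) := by fun_prop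
  ext s hs
  rw [Measure.map_apply hm hs, archMeasure_eq_withDensity, withDensity_apply _ (hm hs),
    withDensity_apply _ hs]
  conv_rhs => rw [← map_planeRotation_volume θ, setLIntegral_map hs hd hm]
  refine lintegral_congr fun p => ?_
  rw [planeRotation_apply]
  congr 1
  linear_combination (-(p.1 ^ 2 + p.2 ^ 2)) * Real.cos_sq_add_sin_sq θ

/-- Polar coordinates for radial functions on the plane. -/
lemma lintegral_radial {G : ℝ → ℝ≥0∞} (hG : Measurable G) :
    ∫⁻ p : ℝ × ℝ, G (p.1 ^ 2 + p.2 ^ 2) =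
      ENNReal.ofReal (2 * π) * ∫⁻ r in Ioi (0 : ℝ), ENNReal.ofReal r * G (r ^ 2) := by
  rw [← lintegral_comp_polarCoord_symm, polarCoord_target, Measure.volume_eq_prod,
    ← Measure.prod_restrict]
  have h (p : ℝ × ℝ) : (polarCoord.symm p).1 ^ 2 + (polarCoord.symm p).2 ^ 2 = p.1 ^ 2 := by
    simp only [polarCoord_symm_apply]
    linear_combination p.1 ^ 2 * Real.cos_sq_add_sin_sq p.2
  simp only [h, smul_eq_mul]
  rw [lintegral_prod _ (by fun_prop)]
  simp only [lintegral_const, Measure.restrict_apply MeasurableSet.univ, univ_inter,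
    Real.volume_Ioo]
  rw [lintegral_mul_const _ (by fun_prop), mul_comm]
  congr 2
  ring

lemma lintegral_Ioo_of_hasDerivAt {F f : ℝ → ℝ} {a b : ℝ} (hab : a ≤ b)
    (hF : ContinuousOn F (Icc a b)) (hd : ∀ x ∈ Ioo a b, HasDerivAt F (f x) x)
    (hf : ∀ x ∈ Ioo a b, 0 ≤ f x) :
    ∫⁻ x in Ioo a b, ENNReal.ofReal (f x) = ENNReal.ofReal (F b - F a) := by
  have hi : IntegrableOn f (Ioc a b) :=
    intervalIntegral.integrableOn_deriv_of_nonneg hF hd hf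
  have h := intervalIntegral.integral_eq_sub_of_hasDerivAt_of_le hab hF hd
    ((intervalIntegrable_iff_integrableOn_Ioc_of_le hab).2 hi)
  rw [← h, intervalIntegral.integral_of_le hab, integral_Ioc_eq_integral_Ioo,
    ofReal_integral_eq_lintegral_ofReal (hi.mono_set Ioo_subset_Ioc_self)]
  exact (ae_restrict_mem measurableSet_Ioo).mono hf

lemma lintegral_radial_archMeasure {g F : ℝ → ℝ} (hg : Measurable g) (hg0 : ∀ u, 0 ≤ u → 0 ≤ g u)
    (hF : ContinuousOn F (Icc 0 1))
    (hd : ∀ r ∈ Ioo (0 : ℝ) 1, HasDerivAt F (r * g (r ^ 2) / √(1 - r ^ 2)) r) :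
    ∫⁻ p, ENNReal.ofReal (g (p.1 ^ 2 + p.2 ^ 2)) ∂archMeasure = ENNReal.ofReal (F 1 - F 0) := by
  rw [archMeasure_eq_withDensity, lintegral_withDensity_eq_lintegral_mul _ (by fun_prop)
    (by fun_prop)]
  simp only [Pi.mul_apply]
  rw [lintegral_radial (G := fun u => archProfile u * ENNReal.ofReal (g u)) (by fun_prop),
    ← lintegral_const_mul _ (by fun_prop), ← lintegral_Ioo_of_hasDerivAt zero_le_one hF hd
    fun r hr => div_nonneg (mul_nonneg hr.1.le (hg0 _ (sq_nonneg r))) (Real.sqrt_nonneg _),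
    ← Ioi_inter_Iio, inter_comm, ← Measure.restrict_restrict measurableSet_Iio,
    ← lintegral_indicator measurableSet_Iio]
  refine setLIntegral_congr_fun measurableSet_Ioi fun r (hr : 0 < r) => ?_
  simp only [archProfile, indicator_apply, mem_Iio]
  by_cases h1 : r < 1
  · have hu : r ^ 2 < 1 := by nlinarith
    have := Real.sqrt_pos.2 (sub_pos.2 hu)
    rw [if_pos hu, if_pos h1, ← ENNReal.ofReal_mul (by positivity),
      ← ENNReal.ofReal_mul (by positivity), ← ENNReal.ofReal_mul (by positivity)]
    congr 1
    field_simp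
  · have hu : ¬ r ^ 2 < 1 := by nlinarith
    simp [hu, h1]

instance isProbabilityMeasure_archMeasure : IsProbabilityMeasure archMeasure := by
  constructor
  have h := lintegral_radial_archMeasure (g := fun _ => 1) (F := fun r => -√(1 - r ^ 2))
    measurable_const (fun _ _ => zero_le_one) (by fun_prop) fun r hr => by
      have hu : 0 < 1 - r ^ 2 := by nlinarith [hr.1, hr.2]
      have hs := Real.sqrt_pos.2 hu
      refine (((hasDerivAt_pow 2 r).const_sub 1).sqrt hu.ne').neg.congr_deriv ?_
      field_simp
      simp
  simpa using h

lemma lintegral_norm_sq_archMeasure :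
    ∫⁻ p, ENNReal.ofReal (p.1 ^ 2 + p.2 ^ 2) ∂archMeasure = ENNReal.ofReal (2 / 3) := by
  have h := lintegral_radial_archMeasure (g := fun u => u)
    (F := fun r => -√(1 - r ^ 2) + (1 - r ^ 2) * √(1 - r ^ 2) / 3)
    measurable_id (fun _ h => h) (by fun_prop) fun r hr => by
      have hu : 0 < 1 - r ^ 2 := by nlinarith [hr.1, hr.2]
      have h1 := (hasDerivAt_pow 2 r).const_sub 1
      have h2 := h1.sqrt hu.ne'
      have h3 := Real.sqrt_pos.2 hu
      have h4 := Real.sq_sqrt hu.le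
      refine (h2.neg.add ((h1.mul h2).div_const 3)).congr_deriv ?_
      field_simp
      simp only [h4]
      norm_num
      ring
  rw [h]
  norm_num

lemma archPath_eq_map (t : ℝ) :
    archPath t = archMeasure.map fun p =>
      (Real.cos (π * t / 2) * p.1 - Real.sin (π * t / 2) * p.2,
        Real.cos (π * t / 2) * p.1 + Real.sin (π * t / 2) * p.2) := by
  rw [archPath, ← map_planeRotation_archMeasure (π * t / 2),
    Measure.map_map (by fun_prop) (measurable_planeRotation _), map_planeRotation_archMeasure]
  congr 1
  funext p
  have hc : Real.cos (π * t) = 2 * Real.cos (π * t / 2) ^ 2 - 1 := by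
    rw [← Real.cos_two_mul]; congr 1; ring
  have hs : Real.sin (π * t) = 2 * Real.sin (π * t / 2) * Real.cos (π * t / 2) := by
    rw [← Real.sin_two_mul]; congr 1; ring
  simp only [Function.comp_apply, planeRotation_apply, hc, hs, Prod.mk.injEq, true_and]
  linear_combination (2 * Real.cos (π * t / 2) * p.1) * Real.cos_sq_add_sin_sq (π * t / 2)

lemma integrable_norm_sq_archMeasure :
    Integrable (fun p : ℝ × ℝ => p.1 ^ 2 + p.2 ^ 2) archMeasure := by
  refine ⟨by fun_prop, ?_⟩
  rw [hasFiniteIntegral_iff_ofReal (ae_of_all _ fun p => by positivity),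
    lintegral_norm_sq_archMeasure]
  exact ENNReal.ofReal_lt_top

lemma memLp_fst_archMeasure : MemLp (fun p : ℝ × ℝ => p.1) 2 archMeasure := by
  rw [memLp_two_iff_integrable_sq (by fun_prop)]
  refine integrable_norm_sq_archMeasure.mono' (by fun_prop) (ae_of_all _ fun p => ?_)
  rw [Real.norm_eq_abs, abs_of_nonneg (sq_nonneg _)]
  nlinarith [sq_nonneg p.2]

lemma memLp_snd_archMeasure : MemLp (fun p : ℝ × ℝ => p.2) 2 archMeasure := by
  rw [memLp_two_iff_integrable_sq (by fun_prop)]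
  refine integrable_norm_sq_archMeasure.mono' (by fun_prop) (ae_of_all _ fun p => ?_)
  rw [Real.norm_eq_abs, abs_of_nonneg (sq_nonneg _)]
  nlinarith [sq_nonneg p.1]

lemma integral_fst_sq_eq_integral_snd_sq_archMeasure :
    ∫ p, p.1 ^ 2 ∂archMeasure = ∫ p, p.2 ^ 2 ∂archMeasure := by
  conv_lhs => rw [← map_planeRotation_archMeasure (π / 2),
    integral_map (measurable_planeRotation _).aemeasurable (by fun_prop)]
  simp [planeRotation_apply]

lemma integral_norm_sq_archMeasure :
    ∫ p, p.1 ^ 2 ∂archMeasure + ∫ p, p.2 ^ 2 ∂archMeasure = 2 / 3 := by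
  rw [← integral_add memLp_fst_archMeasure.integrable_sq memLp_snd_archMeasure.integrable_sq,
    integral_eq_lintegral_of_nonneg_ae (ae_of_all _ fun p => by positivity) (by fun_prop),
    lintegral_norm_sq_archMeasure, ENNReal.toReal_ofReal (by norm_num)]

lemma integral_fst_sq_archMeasure : ∫ p, p.1 ^ 2 ∂archMeasure = 1 / 3 := by
  linarith [integral_fst_sq_eq_integral_snd_sq_archMeasure, integral_norm_sq_archMeasure]

lemma integral_snd_sq_archMeasure : ∫ p, p.2 ^ 2 ∂archMeasure = 1 / 3 := by
  linarith [integral_fst_sq_eq_integral_snd_sq_archMeasure, integral_norm_sq_archMeasure]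

lemma memLp_add_of_map_eq_archPath {Ω : Type*} [MeasurableSpace Ω] {m : Measure Ω}
    {φ : Ω → ℝ × ℝ} (hφ : Measurable φ) {t : ℝ} (h : m.map φ = archPath t) :
    MemLp (fun ω => (φ ω).1 + (φ ω).2) 2 m := by
  refine (memLp_map_measure_iff (g := fun q : ℝ × ℝ => q.1 + q.2) (by fun_prop)
    hφ.aemeasurable).1 ?_
  rw [h, archPath_eq_map, memLp_map_measure_iff (by fun_prop) (by fun_prop)]
  refine (memLp_fst_archMeasure.const_mul (2 * Real.cos (π * t / 2))).ae_eq
    (ae_of_all _ fun p => ?_)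
  simp only [Function.comp_apply]
  ring

lemma memLp_sub_of_map_eq_archPath {Ω : Type*} [MeasurableSpace Ω] {m : Measure Ω}
    {φ : Ω → ℝ × ℝ} (hφ : Measurable φ) {t : ℝ} (h : m.map φ = archPath t) :
    MemLp (fun ω => (φ ω).2 - (φ ω).1) 2 m := by
  refine (memLp_map_measure_iff (g := fun q : ℝ × ℝ => q.2 - q.1) (by fun_prop)
    hφ.aemeasurable).1 ?_
  rw [h, archPath_eq_map, memLp_map_measure_iff (by fun_prop) (by fun_prop)]
  refine (memLp_snd_archMeasure.const_mul (2 * Real.sin (π * t / 2))).ae_eq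
    (ae_of_all _ fun p => ?_)
  simp only [Function.comp_apply]
  ring

lemma integral_add_sq_of_map_eq_archPath {Ω : Type*} [MeasurableSpace Ω] {m : Measure Ω}
    {φ : Ω → ℝ × ℝ} (hφ : Measurable φ) {t : ℝ} (h : m.map φ = archPath t) :
    ∫ ω, ((φ ω).1 + (φ ω).2) ^ 2 ∂m = 4 / 3 * Real.cos (π * t / 2) ^ 2 := by
  rw [← integral_map (f := fun q : ℝ × ℝ => (q.1 + q.2) ^ 2) hφ.aemeasurable (by fun_prop), h,
    archPath_eq_map, integral_map (by fun_prop) (by fun_prop)]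
  calc _ = ∫ p : ℝ × ℝ, 4 * Real.cos (π * t / 2) ^ 2 * p.1 ^ 2 ∂archMeasure := by
        congr 1; funext p; ring
    _ = _ := by rw [integral_const_mul, integral_fst_sq_archMeasure]; ring

lemma integral_sub_sq_of_map_eq_archPath {Ω : Type*} [MeasurableSpace Ω] {m : Measure Ω}
    {φ : Ω → ℝ × ℝ} (hφ : Measurable φ) {t : ℝ} (h : m.map φ = archPath t) :
    ∫ ω, ((φ ω).2 - (φ ω).1) ^ 2 ∂m = 4 / 3 * Real.sin (π * t / 2) ^ 2 := by
  rw [← integral_map (f := fun q : ℝ × ℝ => (q.2 - q.1) ^ 2) hφ.aemeasurable (by fun_prop), h,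
    archPath_eq_map, integral_map (by fun_prop) (by fun_prop)]
  calc _ = ∫ p : ℝ × ℝ, 4 * Real.sin (π * t / 2) ^ 2 * p.2 ^ 2 ∂archMeasure := by
        congr 1; funext p; ring
    _ = _ := by rw [integral_const_mul, integral_snd_sq_archMeasure]; ring

/-- Reverse triangle inequality in `L²`, in terms of second moments. -/
lemma mul_sub_sq_le_integral_sub_sq {Ω : Type*} [MeasurableSpace Ω] {m : Measure Ω} {X Y : Ω → ℝ}
    (hX : MemLp X 2 m) (hY : MemLp Y 2 m) {k a b : ℝ} (hk : 0 ≤ k) (ha : 0 ≤ a) (hb : 0 ≤ b)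
    (hXa : ∫ ω, X ω ^ 2 ∂m = k * a ^ 2) (hYb : ∫ ω, Y ω ^ 2 ∂m = k * b ^ 2) :
    k * (a - b) ^ 2 ≤ ∫ ω, (X ω - Y ω) ^ 2 ∂m := by
  have hXY : Integrable (fun ω => X ω * Y ω) m := hX.integrable_mul hY
  have expand (x : ℝ) : ∫ ω, (x * X ω - Y ω) ^ 2 ∂m =
      k * a ^ 2 * (x * x) + (-2 * ∫ ω, X ω * Y ω ∂m) * x + k * b ^ 2 := by
    have h (ω : Ω) : (x * X ω - Y ω) ^ 2 =
        x ^ 2 * X ω ^ 2 + (-2 * x) * (X ω * Y ω) + Y ω ^ 2 := by ring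
    simp only [h]
    have h12 : Integrable (fun ω => x ^ 2 * X ω ^ 2 + (-2 * x) * (X ω * Y ω)) m :=
      (hX.integrable_sq.const_mul _).add (hXY.const_mul _)
    rw [integral_add h12 hY.integrable_sq,
      integral_add (hX.integrable_sq.const_mul _) (hXY.const_mul _), integral_const_mul,
      integral_const_mul, hXa, hYb]
    ring
  have hd := discrim_le_zero fun x => (expand x).symm ▸ integral_nonneg fun ω => sq_nonneg _
  have hle : ∫ ω, X ω * Y ω ∂m ≤ k * (a * b) := by
    refine le_of_sq_le_sq ?_ (by positivity)
    rw [discrim] at hd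
    linarith
  have h1 := expand 1
  simp only [one_mul] at h1
  rw [h1]
  linarith

lemma W2sqE_archPath {s t : ℝ} (hs : s ∈ Icc (0 : ℝ) 1) (ht : t ∈ Icc (0 : ℝ) 1) :
    W2sqE (archPath s) (archPath t) = 8 / 3 * Real.sin (π * (t - s) / 4) ^ 2 := by
  have hval : 8 / 3 * Real.sin (π * (t - s) / 4) ^ 2 =
      2 / 3 * ((Real.cos (π * s / 2) - Real.cos (π * t / 2)) ^ 2 +
        (Real.sin (π * s / 2) - Real.sin (π * t / 2)) ^ 2) := by
    have h1 := Real.cos_two_mul (π * (t - s) / 4)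
    have h2 := Real.cos_sub (π * t / 2) (π * s / 2)
    rw [show π * t / 2 - π * s / 2 = 2 * (π * (t - s) / 4) by ring] at h2
    linear_combination 8 / 3 * Real.cos_sq_add_sin_sq (π * (t - s) / 4) + 4 / 3 * h1 -
      4 / 3 * h2 - 2 / 3 * Real.cos_sq_add_sin_sq (π * t / 2) -
      2 / 3 * Real.cos_sq_add_sin_sq (π * s / 2)
  have hcos {u : ℝ} (hu : u ∈ Icc (0 : ℝ) 1) : 0 ≤ Real.cos (π * u / 2) :=
    Real.cos_nonneg_of_mem_Icc ⟨by nlinarith [Real.pi_pos, hu.1], by nlinarith [Real.pi_pos, hu.2]⟩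
  have hsin {u : ℝ} (hu : u ∈ Icc (0 : ℝ) 1) : 0 ≤ Real.sin (π * u / 2) :=
    Real.sin_nonneg_of_nonneg_of_le_pi (by nlinarith [Real.pi_pos, hu.1])
      (by nlinarith [Real.pi_pos, hu.2])
  rw [hval]
  refine IsLeast.csInf_eq ⟨?_, ?_⟩
  · refine ⟨archMeasure.map fun p =>
      ((Real.cos (π * s / 2) * p.1 - Real.sin (π * s / 2) * p.2,
        Real.cos (π * s / 2) * p.1 + Real.sin (π * s / 2) * p.2),
        (Real.cos (π * t / 2) * p.1 - Real.sin (π * t / 2) * p.2,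
        Real.cos (π * t / 2) * p.1 + Real.sin (π * t / 2) * p.2)),
      Measure.isProbabilityMeasure_map (by fun_prop), ?_, ?_, ?_⟩
    · rw [Measure.map_map (by fun_prop) (by fun_prop), archPath_eq_map]
      rfl
    · rw [Measure.map_map (by fun_prop) (by fun_prop), archPath_eq_map]
      rfl
    · rw [integral_map (by fun_prop) (by fun_prop)]
      have h (p : ℝ × ℝ) :
          (Real.cos (π * s / 2) * p.1 - Real.sin (π * s / 2) * p.2 -
            (Real.cos (π * t / 2) * p.1 - Real.sin (π * t / 2) * p.2)) ^ 2 +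
          (Real.cos (π * s / 2) * p.1 + Real.sin (π * s / 2) * p.2 -
            (Real.cos (π * t / 2) * p.1 + Real.sin (π * t / 2) * p.2)) ^ 2 =
          2 * (Real.cos (π * s / 2) - Real.cos (π * t / 2)) ^ 2 * p.1 ^ 2 +
          2 * (Real.sin (π * s / 2) - Real.sin (π * t / 2)) ^ 2 * p.2 ^ 2 := by ring
      simp only [h]
      rw [integral_add (memLp_fst_archMeasure.integrable_sq.const_mul _)
        (memLp_snd_archMeasure.integrable_sq.const_mul _), integral_const_mul, integral_const_mul,
        integral_fst_sq_archMeasure, integral_snd_sq_archMeasure]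
      ring
  · rintro e ⟨m, -, hm1, hm2, rfl⟩
    have hVa := memLp_add_of_map_eq_archPath measurable_fst hm1
    have hWa := memLp_add_of_map_eq_archPath measurable_snd hm2
    have hVd := memLp_sub_of_map_eq_archPath measurable_fst hm1
    have hWd := memLp_sub_of_map_eq_archPath measurable_snd hm2
    have h1 := mul_sub_sq_le_integral_sub_sq hVa hWa (by norm_num) (hcos hs) (hcos ht)
      (integral_add_sq_of_map_eq_archPath measurable_fst hm1)
      (integral_add_sq_of_map_eq_archPath measurable_snd hm2)
    have h2 := mul_sub_sq_le_integral_sub_sq hVd hWd (by norm_num) (hsin hs) (hsin ht)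
      (integral_sub_sq_of_map_eq_archPath measurable_fst hm1)
      (integral_sub_sq_of_map_eq_archPath measurable_snd hm2)
    have h (p : (ℝ × ℝ) × (ℝ × ℝ)) : (p.1.1 - p.2.1) ^ 2 + (p.1.2 - p.2.2) ^ 2 =
        1 / 2 * (p.1.1 + p.1.2 - (p.2.1 + p.2.2)) ^ 2 +
        1 / 2 * (p.1.2 - p.1.1 - (p.2.2 - p.2.1)) ^ 2 := by ring
    simp only [h]
    have hia := (hVa.sub hWa).integrable_sq
    have hid := (hVd.sub hWd).integrable_sq
    simp only [Pi.sub_apply] at hia hid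
    rw [integral_add (hia.const_mul _) (hid.const_mul _), integral_const_mul, integral_const_mul]
    linarith

lemma IsPartition.mem_Icc {k : ℕ} {t : ℕ → ℝ} (h : IsPartition k t) {i : ℕ} (hi : i ≤ k) :
    t i ∈ Icc (0 : ℝ) 1 := by
  obtain ⟨-, h0, h1, hlt⟩ := h
  have hmono : MonotoneOn t (Iic k) := by
    refine monotoneOn_of_le_add_one ordConnected_Iic fun a _ _ ha => (hlt a ?_).le
    exact Nat.lt_of_succ_le ha
  exact ⟨h0 ▸ hmono (mem_Iic.2 (Nat.zero_le _)) hi (Nat.zero_le i),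
    h1 ▸ hmono hi (mem_Iic.2 le_rfl) hi⟩

lemma isPartition_uniform (n : ℕ) :
    IsPartition (n + 1) fun i => (i : ℝ) / ((n + 1 : ℕ) : ℝ) := by
  refine ⟨n.succ_pos, by simp, div_self (by positivity), fun i _ => ?_⟩
  exact div_lt_div_of_pos_right (Nat.cast_lt.2 i.lt_succ_self) (by positivity)

lemma tendsto_sq_mul_sin_sq (a : ℝ) :
    Tendsto (fun n : ℕ => ((n : ℝ) * Real.sin (a / n)) ^ 2) atTop (𝓝 (a ^ 2)) := by
  refine Tendsto.pow ?_ 2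
  have h : Tendsto (fun n : ℕ => a * Real.sinc (a / n)) atTop (𝓝 (a * Real.sinc 0)) :=
    ((Real.continuous_sinc.tendsto 0).comp (tendsto_const_div_atTop_nhds_zero_nat a)).const_mul a
  rw [Real.sinc_zero, mul_one] at h
  refine h.congr' ?_
  filter_upwards [eventually_gt_atTop 0] with n hn
  rcases eq_or_ne a 0 with rfl | ha
  · simp
  · have : (n : ℝ) ≠ 0 := by positivity
    rw [Real.sinc_of_ne_zero (by positivity)]
    field_simp

/-- the energy of the Archimedean path in the 2-Wasserstein metric is π²/6. -/
theorem archimedean_path_energy :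
    energyOf (fun s t => W2sqE (archPath s) (archPath t)) = ENNReal.ofReal (π ^ 2 / 6) := by
  apply le_antisymm
  · refine iSup_le fun k => iSup_le fun t => iSup_le fun h => ENNReal.ofReal_le_ofReal ?_
    calc ∑ i ∈ Finset.range k, W2sqE (archPath (t i)) (archPath (t (i + 1))) / (t (i + 1) - t i)
        ≤ ∑ i ∈ Finset.range k, π ^ 2 / 6 * (t (i + 1) - t i) := by
          refine Finset.sum_le_sum fun i hi => ?_
          have hik := Finset.mem_range.1 hi
          have hpos := sub_pos.2 (h.2.2.2 i hik)
          rw [W2sqE_archPath (h.mem_Icc hik.le) (h.mem_Icc hik), div_le_iff₀ hpos]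
          have := Real.sin_sq_le_sq (x := π * (t (i + 1) - t i) / 4)
          linarith
      _ = π ^ 2 / 6 := by
          rw [← Finset.mul_sum, Finset.sum_range_sub, h.2.1, h.2.2.1]
          ring
  · have hlim := ((tendsto_sq_mul_sin_sq (π / 4)).comp (tendsto_add_atTop_nat 1)).const_mul (8 / 3)
    rw [show 8 / 3 * (π / 4) ^ 2 = π ^ 2 / 6 by ring] at hlim
    refine le_of_tendsto' (ENNReal.tendsto_ofReal hlim) fun n => ?_
    have hP := isPartition_uniform n
    refine le_trans (le_of_eq ?_) (le_iSup_of_le (n + 1) (le_iSup_of_le _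
      (le_iSup_of_le hP le_rfl)))
    congr 1
    have hterm : ∀ i ∈ Finset.range (n + 1),
        W2sqE (archPath ((i : ℝ) / ((n + 1 : ℕ) : ℝ)))
          (archPath (((i + 1 : ℕ) : ℝ) / ((n + 1 : ℕ) : ℝ))) /
          (((i + 1 : ℕ) : ℝ) / ((n + 1 : ℕ) : ℝ) - (i : ℝ) / ((n + 1 : ℕ) : ℝ)) =
        8 / 3 * Real.sin (π / 4 / ((n + 1 : ℕ) : ℝ)) ^ 2 * ((n + 1 : ℕ) : ℝ) := by
      intro i hi
      have hik := Finset.mem_range.1 hi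
      rw [W2sqE_archPath (hP.mem_Icc hik.le) (hP.mem_Icc hik)]
      have hstep : ((i + 1 : ℕ) : ℝ) / ((n + 1 : ℕ) : ℝ) - (i : ℝ) / ((n + 1 : ℕ) : ℝ) =
          1 / ((n + 1 : ℕ) : ℝ) := by
        rw [← sub_div]; simp
      rw [hstep, show π * (1 / ((n + 1 : ℕ) : ℝ)) / 4 = π / 4 / ((n + 1 : ℕ) : ℝ) by ring]
      field_simp
    rw [Finset.sum_congr rfl hterm, Finset.sum_const, Finset.card_range, nsmul_eq_mul]
    simp only [Function.comp_apply]
    ring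
end

section
/- For every permuton P, with (X,Y) ~ P, one has W₂(id, P)² + W₂(P, rev)² ≥ (8 − 4√2)/3, with equality if and only if the law of the rotated pair ((X − Y)/√2, (X + Y)/√2) is also a permuton. In particular, the function P ↦ W₂(id,P)² + W₂(P,rev)² on the space of permutons is minimized by P if and only if the rotated pair is a permuton, so the Archimedean measure is not the unique minimizer. -/
open MeasureTheory Set Filter
open scoped ENNReal Real Topology

/-- The uniform probability measure on [-1,1]. -/
noncomputable def unif : Measure ℝ := (2 : ℝ≥0∞)⁻¹ • (volume.restrict (Icc (-1 : ℝ) 1))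

/-- A permuton: a Borel probability measure on the plane whose coordinate marginals
are uniform on [-1,1]. -/
def IsPermuton (μ : Measure (ℝ × ℝ)) : Prop :=
  IsProbabilityMeasure μ ∧ μ.map Prod.fst = unif ∧ μ.map Prod.snd = unif

/-- The identity permuton, the law of (X, X) with X ~ Uniform[-1,1]. -/
noncomputable def idPermuton : Measure (ℝ × ℝ) := unif.map (fun x => (x, x))

/-- The reverse permuton, the law of (X, -X) with X ~ Uniform[-1,1]. -/
noncomputable def revPermuton : Measure (ℝ × ℝ) := unif.map (fun x => (x, -x))

instance : IsProbabilityMeasure unif := by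
  constructor
  rw [unif, Measure.smul_apply, Measure.restrict_apply_univ, Real.volume_Icc]
  norm_num
  exact ENNReal.inv_mul_cancel (by norm_num) (by norm_num)

lemma integral_unif (f : ℝ → ℝ) : ∫ x, f x ∂unif = (∫ x in (-1 : ℝ)..1, f x) / 2 := by
  rw [unif, integral_smul_measure, intervalIntegral.integral_of_le (by norm_num),
    integral_Icc_eq_integral_Ioc]
  simp
  ring

lemma integral_sq_unif : ∫ x, x ^ 2 ∂unif = 1 / 3 := by
  rw [integral_unif, integral_pow]
  norm_num

lemma memLp_id_unif : MemLp (fun x : ℝ => x) 2 unif := by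
  refine MemLp.of_bound (by fun_prop) 1 ?_
  refine Measure.ae_smul_measure ?_ _
  filter_upwards [ae_restrict_mem measurableSet_Icc] with x hx
  rw [Real.norm_eq_abs, abs_le]
  exact hx

section UniformVariables

variable {Ω : Type*} [MeasurableSpace Ω] {m : Measure Ω} {U : Ω → ℝ}

lemma memLp_of_map_eq_unif (hU : Measurable U) (h : m.map U = unif) : MemLp U 2 m := by
  have := memLp_id_unif
  rw [← h] at this
  exact (memLp_map_measure_iff (by fun_prop) hU.aemeasurable).1 this

lemma integral_sq_of_map_eq_unif (hU : Measurable U) (h : m.map U = unif) :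
    ∫ ω, U ω ^ 2 ∂m = 1 / 3 := by
  rw [← integral_sq_unif, ← h, integral_map hU.aemeasurable (by fun_prop)]

end UniformVariables

/-- Two laws on the line which admit couplings of arbitrarily small quadratic cost are equal. -/
lemma eq_of_forall_exists_coupling_lt {Ω : Type*} [MeasurableSpace Ω] {α β : Measure ℝ}
    [IsFiniteMeasure α] [IsFiniteMeasure β] {U V : Ω → ℝ} (hU : Measurable U) (hV : Measurable V)
    (h : ∀ ε > 0, ∃ m : Measure Ω, IsProbabilityMeasure m ∧ m.map U = α ∧ m.map V = β ∧
      Integrable (fun ω => (U ω - V ω) ^ 2) m ∧ ∫ ω, (U ω - V ω) ^ 2 ∂m < ε) : α = β := by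
  refine Measure.ext_of_charFun (funext fun t => ?_)
  rw [← sub_eq_zero, ← norm_le_zero_iff]
  have key : ∀ δ > 0, ‖charFun α t - charFun β t‖ ≤ |t| * δ := by
    intro δ hδ
    obtain ⟨m, hm, rfl, rfl, hint, hlt⟩ := h (δ ^ 2) (by positivity)
    have hexp : ∀ W : Ω → ℝ, Measurable W →
        Integrable (fun ω => Complex.exp (t * W ω * Complex.I)) m := by
      intro W hW
      refine Integrable.of_bound (by fun_prop) 1 (.of_forall fun ω => ?_)
      rw [← Complex.ofReal_mul, Complex.norm_exp_ofReal_mul_I]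
    rw [charFun_apply_real, charFun_apply_real, integral_map hU.aemeasurable (by fun_prop),
      integral_map hV.aemeasurable (by fun_prop), ← integral_sub (hexp U hU) (hexp V hV)]
    have hpt : ∀ ω, ‖Complex.exp (t * U ω * Complex.I) - Complex.exp (t * V ω * Complex.I)‖ ≤
        |t| * ((δ + (U ω - V ω) ^ 2 / δ) / 2) := by
      intro ω
      have h1 : Complex.exp (t * U ω * Complex.I) - Complex.exp (t * V ω * Complex.I) =
          Complex.exp ((t * V ω : ℝ) * Complex.I) *
            (Complex.exp (Complex.I * (t * (U ω - V ω) : ℝ)) - 1) := by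
        rw [mul_sub, ← Complex.exp_add, mul_one]
        push_cast
        ring_nf
      rw [h1, norm_mul, Complex.norm_exp_ofReal_mul_I, one_mul]
      refine Real.norm_exp_I_mul_ofReal_sub_one_le.trans ?_
      rw [norm_mul, Real.norm_eq_abs, Real.norm_eq_abs]
      refine mul_le_mul_of_nonneg_left ?_ (abs_nonneg t)
      have h2 : (U ω - V ω) ^ 2 / δ * δ = |U ω - V ω| ^ 2 := by
        rw [sq_abs]; field_simp
      have h3 : 0 ≤ (U ω - V ω) ^ 2 / δ := by positivity
      nlinarith [sq_nonneg (|U ω - V ω| - δ)]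
    have hint2 : Integrable (fun ω => |t| * ((δ + (U ω - V ω) ^ 2 / δ) / 2)) m :=
      (((integrable_const δ).add (hint.div_const δ)).div_const 2).const_mul |t|
    refine (norm_integral_le_integral_norm _).trans
      ((integral_mono ((hexp U hU).sub (hexp V hV)).norm hint2 hpt).trans ?_)
    rw [integral_const_mul, integral_div, integral_add (integrable_const δ) (hint.div_const δ),
      integral_div]
    refine mul_le_mul_of_nonneg_left ?_ (abs_nonneg t)
    have : (∫ ω, (U ω - V ω) ^ 2 ∂m) / δ ≤ δ := by
      rw [div_le_iff₀ hδ]; nlinarith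
    simp only [integral_const, probReal_univ, one_smul]
    linarith
  refine le_of_forall_pos_le_add fun ε hε => ?_
  have := key (ε / (|t| + 1)) (by positivity)
  refine this.trans ?_
  rw [zero_add, mul_div_assoc', div_le_iff₀ (by positivity)]
  nlinarith [abs_nonneg t]

lemma W2sqE_comm (μ ν : Measure (ℝ × ℝ)) : W2sqE μ ν = W2sqE ν μ := by
  have aux : ∀ (μ ν : Measure (ℝ × ℝ)) (e : ℝ),
      (∃ m : Measure ((ℝ × ℝ) × (ℝ × ℝ)), IsProbabilityMeasure m ∧
        m.map Prod.fst = μ ∧ m.map Prod.snd = ν ∧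
          e = ∫ p, ((p.1.1 - p.2.1) ^ 2 + (p.1.2 - p.2.2) ^ 2) ∂m) →
      ∃ m : Measure ((ℝ × ℝ) × (ℝ × ℝ)), IsProbabilityMeasure m ∧
        m.map Prod.fst = ν ∧ m.map Prod.snd = μ ∧
          e = ∫ p, ((p.1.1 - p.2.1) ^ 2 + (p.1.2 - p.2.2) ^ 2) ∂m := by
    rintro μ ν e ⟨m, hm, rfl, rfl, rfl⟩
    refine ⟨m.map Prod.swap, Measure.isProbabilityMeasure_map (by fun_prop), ?_, ?_, ?_⟩
    · rw [Measure.map_map measurable_fst measurable_swap]; rfl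
    · rw [Measure.map_map measurable_snd measurable_swap]; rfl
    · rw [integral_map (by fun_prop) (by fun_prop)]
      refine integral_congr_ae (.of_forall fun p => ?_)
      simp only [Prod.fst_swap, Prod.snd_swap]
      ring
  unfold W2sqE W2sqCost
  congr 1
  ext e
  exact ⟨aux μ ν e, aux ν μ e⟩

/-- The law of `(X, σ X)` with `X` uniform on `[-1,1]`. -/
noncomputable def diagPermuton (σ : ℝ) : Measure (ℝ × ℝ) := unif.map fun x => (x, σ * x)

lemma idPermuton_eq_diagPermuton : idPermuton = diagPermuton 1 := by
  simp [idPermuton, diagPermuton]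

lemma revPermuton_eq_diagPermuton : revPermuton = diagPermuton (-1) := by
  simp [revPermuton, diagPermuton]

instance (σ : ℝ) : IsProbabilityMeasure (diagPermuton σ) :=
  Measure.isProbabilityMeasure_map (by fun_prop)

/-- The normalised diagonal coordinate of the plane in direction `(1, σ)`. -/
noncomputable def diagCoord (σ : ℝ) (p : ℝ × ℝ) : ℝ := (p.1 + σ * p.2) / √2

lemma measurable_diagCoord (σ : ℝ) : Measurable (diagCoord σ) := by
  unfold diagCoord
  fun_prop

/-- The part of the transportation cost from `diagPermuton σ` which does not depend on the
coupling. -/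
noncomputable def diagCost (σ : ℝ) (μ : Measure (ℝ × ℝ)) : ℝ :=
  (4 - √2) / 3 - √2 * ∫ p, diagCoord σ p ^ 2 ∂μ

section Permuton

variable {μ : Measure (ℝ × ℝ)} {σ : ℝ}

lemma IsPermuton.memLp_fst (h : IsPermuton μ) : MemLp (fun p : ℝ × ℝ => p.1) 2 μ :=
  memLp_of_map_eq_unif measurable_fst h.2.1

lemma IsPermuton.memLp_snd (h : IsPermuton μ) : MemLp (fun p : ℝ × ℝ => p.2) 2 μ :=
  memLp_of_map_eq_unif measurable_snd h.2.2

lemma IsPermuton.memLp_diagCoord (h : IsPermuton μ) (σ : ℝ) : MemLp (diagCoord σ) 2 μ := by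
  have := (h.memLp_fst.add (h.memLp_snd.const_mul σ)).mul_const (√2)⁻¹
  exact this

lemma IsPermuton.diagCost_add_diagCost (h : IsPermuton μ) :
    diagCost 1 μ + diagCost (-1) μ = (8 - 4 * √2) / 3 := by
  have h1 : (∫ p, diagCoord 1 p ^ 2 ∂μ) + ∫ p, diagCoord (-1) p ^ 2 ∂μ = 2 / 3 := by
    rw [← integral_add (h.memLp_diagCoord 1).integrable_sq (h.memLp_diagCoord (-1)).integrable_sq]
    have hpt : ∀ p : ℝ × ℝ, diagCoord 1 p ^ 2 + diagCoord (-1) p ^ 2 = p.1 ^ 2 + p.2 ^ 2 := by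
      intro p
      simp only [diagCoord, div_pow, Real.sq_sqrt (zero_le_two (α := ℝ))]
      ring
    simp_rw [hpt]
    rw [integral_add h.memLp_fst.integrable_sq h.memLp_snd.integrable_sq,
      integral_sq_of_map_eq_unif measurable_fst h.2.1,
      integral_sq_of_map_eq_unif measurable_snd h.2.2]
    norm_num
  unfold diagCost
  linear_combination (-√2) * h1

/-- The transportation cost of a coupling with `diagPermuton σ` exceeds `diagCost` by the cost of
the induced coupling of the uniform law with the diagonal coordinate. -/
lemma IsPermuton.integral_cost_eq (h : IsPermuton μ) (hσ : σ ^ 2 = 1)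
    {m : Measure ((ℝ × ℝ) × (ℝ × ℝ))}
    (h1 : m.map Prod.fst = diagPermuton σ) (h2 : m.map Prod.snd = μ) :
    m.map (fun p => p.1.1) = unif ∧
    Integrable (fun p => (p.1.1 - diagCoord σ p.2) ^ 2) m ∧
    ∫ p, ((p.1.1 - p.2.1) ^ 2 + (p.1.2 - p.2.2) ^ 2) ∂m =
      diagCost σ μ + √2 * ∫ p, (p.1.1 - diagCoord σ p.2) ^ 2 ∂m := by
  have hs0 : √2 ≠ 0 := by positivity
  have hU : m.map (fun p => p.1.1) = unif := by
    have : (fun p : (ℝ × ℝ) × (ℝ × ℝ) => p.1.1) = Prod.fst ∘ Prod.fst := rfl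
    rw [this, ← Measure.map_map measurable_fst measurable_fst, h1, diagPermuton,
      Measure.map_map measurable_fst (by fun_prop)]
    exact Measure.map_id
  have hdiag : ∀ᵐ p ∂m, p.1.2 = σ * p.1.1 := by
    have : ∀ᵐ q ∂(m.map Prod.fst), q.2 = σ * q.1 := by
      rw [h1, diagPermuton, ae_map_iff (by fun_prop)
        (measurableSet_eq_fun measurable_snd (by fun_prop))]
      exact .of_forall fun x => rfl
    exact ae_of_ae_map (by fun_prop) this
  have hX : m.map (fun p => p.2.1) = unif := by
    have : (fun p : (ℝ × ℝ) × (ℝ × ℝ) => p.2.1) = Prod.fst ∘ Prod.snd := rfl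
    rw [this, ← Measure.map_map measurable_fst measurable_snd, h2, h.2.1]
  have hY : m.map (fun p => p.2.2) = unif := by
    have : (fun p : (ℝ × ℝ) × (ℝ × ℝ) => p.2.2) = Prod.snd ∘ Prod.snd := rfl
    rw [this, ← Measure.map_map measurable_snd measurable_snd, h2, h.2.2]
  have hAm := measurable_diagCoord σ
  have iU := memLp_of_map_eq_unif (by fun_prop) hU
  have iX := memLp_of_map_eq_unif (by fun_prop) hX
  have iY := memLp_of_map_eq_unif (by fun_prop) hY
  have iA : MemLp (fun p : (ℝ × ℝ) × (ℝ × ℝ) => diagCoord σ p.2) 2 m := by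
    have := h.memLp_diagCoord σ
    rw [← h2] at this
    exact (memLp_map_measure_iff (by fun_prop) measurable_snd.aemeasurable).1 this
  have iD : Integrable (fun p => (p.1.1 - diagCoord σ p.2) ^ 2) m := (iU.sub iA).integrable_sq
  refine ⟨hU, iD, ?_⟩
  have hcost : ∫ p, ((p.1.1 - p.2.1) ^ 2 + (p.1.2 - p.2.2) ^ 2) ∂m =
      ∫ p, ((((2 - √2) * p.1.1 ^ 2 + p.2.1 ^ 2) + p.2.2 ^ 2 + (-√2) * diagCoord σ p.2 ^ 2) +
        √2 * (p.1.1 - diagCoord σ p.2) ^ 2) ∂m := by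
    refine integral_congr_ae ?_
    filter_upwards [hdiag] with p hp
    have hA : √2 * diagCoord σ p.2 = p.2.1 + σ * p.2.2 := by
      unfold diagCoord; field_simp
    rw [hp]
    linear_combination (p.1.1 ^ 2) * hσ + 2 * p.1.1 * hA
  have hAsq : ∫ p, diagCoord σ p.2 ^ 2 ∂m = ∫ p, diagCoord σ p ^ 2 ∂μ := by
    rw [← h2, integral_map (by fun_prop) (by fun_prop)]
  have iUX : Integrable (fun p => (2 - √2) * p.1.1 ^ 2 + p.2.1 ^ 2) m :=
    (iU.integrable_sq.const_mul _).add iX.integrable_sq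
  have iUXY : Integrable (fun p => (2 - √2) * p.1.1 ^ 2 + p.2.1 ^ 2 + p.2.2 ^ 2) m :=
    iUX.add iY.integrable_sq
  have iUXYA : Integrable (fun p => (2 - √2) * p.1.1 ^ 2 + p.2.1 ^ 2 + p.2.2 ^ 2 +
      (-√2) * diagCoord σ p.2 ^ 2) m :=
    iUXY.add (iA.integrable_sq.const_mul _)
  rw [hcost, integral_add iUXYA (iD.const_mul _),
    integral_add iUXY (iA.integrable_sq.const_mul _), integral_add iUX iY.integrable_sq,
    integral_add (iU.integrable_sq.const_mul _) iX.integrable_sq,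
    integral_const_mul, integral_const_mul, integral_const_mul, hAsq,
    integral_sq_of_map_eq_unif (by fun_prop) hU, integral_sq_of_map_eq_unif (by fun_prop) hX,
    integral_sq_of_map_eq_unif (by fun_prop) hY]
  unfold diagCost
  ring

lemma W2sqE_le_integral {μ ν : Measure (ℝ × ℝ)} {m : Measure ((ℝ × ℝ) × (ℝ × ℝ))}
    [hm : IsProbabilityMeasure m] (h1 : m.map Prod.fst = μ) (h2 : m.map Prod.snd = ν) :
    W2sqE μ ν ≤ ∫ p, ((p.1.1 - p.2.1) ^ 2 + (p.1.2 - p.2.2) ^ 2) ∂m := by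
  refine csInf_le ⟨0, ?_⟩ ⟨m, hm, h1, h2, rfl⟩
  rintro e ⟨m', -, -, -, rfl⟩
  exact integral_nonneg fun p => by positivity

lemma exists_coupling_lt {μ ν : Measure (ℝ × ℝ)} [IsProbabilityMeasure μ]
    [IsProbabilityMeasure ν] {c : ℝ} (hc : W2sqE μ ν < c) :
    ∃ m : Measure ((ℝ × ℝ) × (ℝ × ℝ)), IsProbabilityMeasure m ∧ m.map Prod.fst = μ ∧
      m.map Prod.snd = ν ∧ ∫ p, ((p.1.1 - p.2.1) ^ 2 + (p.1.2 - p.2.2) ^ 2) ∂m < c := by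
  rw [W2sqE, W2sqCost] at hc
  obtain ⟨e, ⟨m, hm, h1, h2, rfl⟩, hlt⟩ := exists_lt_of_csInf_lt (by
    exact ⟨_, μ.prod ν, inferInstance, by simp, by simp, rfl⟩) hc
  exact ⟨m, hm, h1, h2, hlt⟩

lemma IsPermuton.diagCost_le (h : IsPermuton μ) (hσ : σ ^ 2 = 1) :
    diagCost σ μ ≤ W2sqE (diagPermuton σ) μ := by
  have := h.1
  refine le_of_not_gt fun hlt => ?_
  obtain ⟨m, hm, h1, h2, hm'⟩ := exists_coupling_lt hlt
  rw [(h.integral_cost_eq hσ h1 h2).2.2] at hm'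
  have : 0 ≤ ∫ p, (p.1.1 - diagCoord σ p.2) ^ 2 ∂m := integral_nonneg fun p => by positivity
  nlinarith [Real.sqrt_nonneg 2]

lemma IsPermuton.W2sqE_eq_diagCost_iff (h : IsPermuton μ) (hσ : σ ^ 2 = 1) :
    W2sqE (diagPermuton σ) μ = diagCost σ μ ↔ μ.map (diagCoord σ) = unif := by
  have := h.1
  have hAm := measurable_diagCoord σ
  have hs0 : 0 < √2 := by positivity
  constructor
  · intro heq
    have : IsProbabilityMeasure (μ.map (diagCoord σ)) :=
      Measure.isProbabilityMeasure_map hAm.aemeasurable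
    refine (eq_of_forall_exists_coupling_lt
      (U := fun p : (ℝ × ℝ) × (ℝ × ℝ) => p.1.1) (V := fun p => diagCoord σ p.2)
      (by fun_prop) (by fun_prop) fun ε hε => ?_).symm
    obtain ⟨m, hm, h1, h2, hlt⟩ := exists_coupling_lt
      (show W2sqE (diagPermuton σ) μ < diagCost σ μ + √2 * ε by
        rw [heq]; exact lt_add_of_pos_right _ (by positivity))
    obtain ⟨hU, hint, hc⟩ := h.integral_cost_eq hσ h1 h2
    refine ⟨m, hm, hU, ?_, hint, ?_⟩
    · rw [← h2, Measure.map_map hAm measurable_snd]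
      rfl
    · rw [hc] at hlt
      exact lt_of_mul_lt_mul_left (lt_of_add_lt_add_left hlt) hs0.le
  · intro hA
    refine le_antisymm ?_ (h.diagCost_le hσ)
    let g : ℝ × ℝ → (ℝ × ℝ) × (ℝ × ℝ) := fun p => ((diagCoord σ p, σ * diagCoord σ p), p)
    have hg : Measurable g := by fun_prop
    have : IsProbabilityMeasure (μ.map g) := Measure.isProbabilityMeasure_map hg.aemeasurable
    have h1 : (μ.map g).map Prod.fst = diagPermuton σ := by
      rw [Measure.map_map measurable_fst hg, diagPermuton, ← hA,
        Measure.map_map (by fun_prop) hAm]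
      rfl
    have h2 : (μ.map g).map Prod.snd = μ := by
      rw [Measure.map_map measurable_snd hg]
      exact Measure.map_id
    refine (W2sqE_le_integral h1 h2).trans ?_
    rw [(h.integral_cost_eq hσ h1 h2).2.2, integral_map hg.aemeasurable (by fun_prop)]
    simp [g]

lemma IsPermuton.le_W2sqE_add (h : IsPermuton μ) :
    (8 - 4 * √2) / 3 ≤ W2sqE idPermuton μ + W2sqE μ revPermuton := by
  rw [W2sqE_comm μ, idPermuton_eq_diagPermuton, revPermuton_eq_diagPermuton,
    ← h.diagCost_add_diagCost]
  exact add_le_add (h.diagCost_le (by norm_num)) (h.diagCost_le (by norm_num))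

lemma IsPermuton.rotation_isPermuton_iff (h : IsPermuton μ) :
    IsPermuton (μ.map fun p => ((p.1 - p.2) / √2, (p.1 + p.2) / √2)) ↔
      μ.map (diagCoord 1) = unif ∧ μ.map (diagCoord (-1)) = unif := by
  have := h.1
  have hr : Measurable fun p : ℝ × ℝ => ((p.1 - p.2) / √2, (p.1 + p.2) / √2) := by fun_prop
  have e1 : (μ.map fun p => ((p.1 - p.2) / √2, (p.1 + p.2) / √2)).map Prod.fst =
      μ.map (diagCoord (-1)) := by
    rw [Measure.map_map measurable_fst hr]
    congr 1
    ext p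
    simp only [Function.comp, diagCoord]
    ring
  have e2 : (μ.map fun p => ((p.1 - p.2) / √2, (p.1 + p.2) / √2)).map Prod.snd =
      μ.map (diagCoord 1) := by
    rw [Measure.map_map measurable_snd hr]
    congr 1
    ext p
    simp only [Function.comp, diagCoord]
    ring
  rw [IsPermuton, e1, e2, and_iff_right (Measure.isProbabilityMeasure_map hr.aemeasurable),
    and_comm]

lemma IsPermuton.W2sqE_add_eq_iff (h : IsPermuton μ) :
    W2sqE idPermuton μ + W2sqE μ revPermuton = (8 - 4 * √2) / 3 ↔
      IsPermuton (μ.map fun p => ((p.1 - p.2) / √2, (p.1 + p.2) / √2)) := by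
  rw [h.rotation_isPermuton_iff, ← h.W2sqE_eq_diagCost_iff (by norm_num),
    ← h.W2sqE_eq_diagCost_iff (by norm_num), W2sqE_comm μ, idPermuton_eq_diagPermuton,
    revPermuton_eq_diagPermuton, ← h.diagCost_add_diagCost, eq_comm,
    add_eq_add_iff_eq_and_eq (h.diagCost_le (by norm_num)) (h.diagCost_le (by norm_num)),
    eq_comm, @eq_comm _ (diagCost (-1) μ)]

end Permuton

/-- The affine parametrisation over `[-1,1]` of the segment from `a` to `b`. -/
noncomputable def segmentMap (a b t : ℝ) : ℝ := (a + b) / 2 + (b - a) / 2 * t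

lemma measurable_segmentMap (a b : ℝ) : Measurable (segmentMap a b) := by
  unfold segmentMap
  fun_prop

lemma integral_map_segmentMap {a b : ℝ} (hab : b ≠ a) {f : ℝ → ℝ} (hf : Continuous f) :
    ∫ x, f x ∂(unif.map (segmentMap a b)) =
      ((∫ x in (0 : ℝ)..b, f x) - ∫ x in (0 : ℝ)..a, f x) / (b - a) := by
  have hr : (b - a) / 2 ≠ 0 := div_ne_zero (sub_ne_zero.2 hab) two_ne_zero
  rw [integral_map (measurable_segmentMap a b).aemeasurable (by fun_prop), integral_unif,
    intervalIntegral.integral_interval_sub_left (hf.intervalIntegrable _ _)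
      (hf.intervalIntegrable _ _)]
  unfold segmentMap
  rw [intervalIntegral.integral_comp_add_mul f hr,
    show (a + b) / 2 + (b - a) / 2 * -1 = a by ring,
    show (a + b) / 2 + (b - a) / 2 * 1 = b by ring, smul_eq_mul]
  have := sub_ne_zero.2 hab
  field_simp

/-- The first coordinates of the vertices of the regular octagon inscribed in the unit circle. -/
noncomputable def octagonCos : Fin 8 → ℝ := ![1, √2 / 2, 0, -(√2 / 2), -1, -(√2 / 2), 0, √2 / 2]

lemma sqrt_two_div_two_lt_one : √2 / 2 < 1 := by
  have : √2 < 2 := (Real.sqrt_lt' two_pos).2 (by norm_num)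
  linarith

lemma octagonCos_ne (k : Fin 8) :
    octagonCos (k + 1) ≠ octagonCos k ∧ octagonCos (k + 3) ≠ octagonCos k := by
  have h1 := sqrt_two_div_two_lt_one
  have h0 : 0 < √2 / 2 := by positivity
  have e : ∀ i : Fin 8, octagonCos i =
    (![1, √2 / 2, 0, -(√2 / 2), -1, -(√2 / 2), 0, √2 / 2] : Fin 8 → ℝ) i := fun _ => rfl
  generalize √2 / 2 = s at *
  constructor <;> fin_cases k <;> simp [e] <;> grind

/-- The average of the uniform measures on the sides of the regular octagon and on those of the
octagram `{8/3}` projects to the uniform measure. -/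
lemma sum_map_segmentMap_octagonCos :
    (16 : ℝ≥0∞)⁻¹ • ∑ k, (unif.map (segmentMap (octagonCos k) (octagonCos (k + 1))) +
      unif.map (segmentMap (octagonCos k) (octagonCos (k + 3)))) = unif := by
  have hp : ∀ a b, IsProbabilityMeasure (unif.map (segmentMap a b)) := fun a b =>
    Measure.isProbabilityMeasure_map (measurable_segmentMap a b).aemeasurable
  have hfin : IsFiniteMeasure ((16 : ℝ≥0∞)⁻¹ •
      ∑ k, (unif.map (segmentMap (octagonCos k) (octagonCos (k + 1))) +
      unif.map (segmentMap (octagonCos k) (octagonCos (k + 3))))) :=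
    Measure.smul_finite _ (by simp)
  refine ext_of_forall_integral_eq_of_IsFiniteMeasure fun f => ?_
  have hf := f.continuous
  have hi : ∀ (m : Measure ℝ) [IsProbabilityMeasure m], Integrable f m := fun m _ =>
    f.integrable m
  rw [integral_smul_measure, integral_finsetSum_measure
    fun k _ => (hi _).add_measure (hi _)]
  simp_rw [integral_add_measure (hi _) (hi _)]
  have hk : ∀ k, (∫ x, f x ∂(unif.map (segmentMap (octagonCos k) (octagonCos (k + 1))))) +
      ∫ x, f x ∂(unif.map (segmentMap (octagonCos k) (octagonCos (k + 3)))) =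
      ((∫ x in (0 : ℝ)..octagonCos (k + 1), f x) - ∫ x in (0 : ℝ)..octagonCos k, f x) /
        (octagonCos (k + 1) - octagonCos k) +
      ((∫ x in (0 : ℝ)..octagonCos (k + 3), f x) - ∫ x in (0 : ℝ)..octagonCos k, f x) /
        (octagonCos (k + 3) - octagonCos k) := fun k => by
    rw [integral_map_segmentMap (octagonCos_ne k).1 hf,
      integral_map_segmentMap (octagonCos_ne k).2 hf]
  simp_rw [hk]
  rw [integral_unif, ← intervalIntegral.integral_interval_sub_left (a := 0)
    (hf.intervalIntegrable _ _) (hf.intervalIntegrable _ _)]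
  have hs : 2 * (√2 / 2) ^ 2 = 1 := by
    rw [div_pow, Real.sq_sqrt zero_le_two]; norm_num
  have e : ∀ i : Fin 8, octagonCos i =
    (![1, √2 / 2, 0, -(√2 / 2), -1, -(√2 / 2), 0, √2 / 2] : Fin 8 → ℝ) i := fun _ => rfl
  generalize √2 / 2 = s at *
  rw [Fin.sum_univ_eight]
  simp [e]
  generalize (∫ x in (0 : ℝ)..1, f x) = F1
  generalize (∫ x in (0 : ℝ)..-1, f x) = F2
  generalize (∫ x in (0 : ℝ)..s, f x) = F3
  generalize (∫ x in (0 : ℝ)..-s, f x) = F4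
  have i1 : (1 - s)⁻¹ = 2 * (1 + s) := inv_eq_of_mul_eq_one_right (by linarith)
  have i2 : (1 + s)⁻¹ = 2 * (1 - s) := inv_eq_of_mul_eq_one_right (by linarith)
  have i3 : s⁻¹ = 2 * s := inv_eq_of_mul_eq_one_right (by linarith)
  rw [show s - 1 = -(1 - s) by ring, show -s - 1 = -(1 + s) by ring,
    show -1 - s = -(1 + s) by ring, show -1 + s = -(1 - s) by ring,
    show -s + 1 = 1 - s by ring, show s + 1 = 1 + s by ring]
  simp only [div_eq_mul_inv, inv_neg, i1, i2, i3]
  ring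

/-- The uniform measure on the segment between the vertices `k` and `l` of the regular octagon. -/
noncomputable def octagonChord (k l : Fin 8) : Measure (ℝ × ℝ) :=
  unif.map fun t => (segmentMap (octagonCos k) (octagonCos l) t,
    segmentMap (octagonCos (k - 2)) (octagonCos (l - 2)) t)

/-- The average of the uniform measures on the sides of the regular octagon and of the
octagram `{8/3}`. -/
noncomputable def octagonMeasure : Measure (ℝ × ℝ) :=
  (16 : ℝ≥0∞)⁻¹ • ∑ k, (octagonChord k (k + 1) + octagonChord k (k + 3))

lemma map_octagonMeasure {g : ℝ × ℝ → ℝ} (hg : Measurable g) (j : Fin 8)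
    (h : ∀ k l t, g (segmentMap (octagonCos k) (octagonCos l) t,
      segmentMap (octagonCos (k - 2)) (octagonCos (l - 2)) t) =
        segmentMap (octagonCos (k + j)) (octagonCos (l + j)) t) :
    octagonMeasure.map g = unif := by
  have hc : ∀ k l, (octagonChord k l).map g =
      unif.map (segmentMap (octagonCos (k + j)) (octagonCos (l + j))) := by
    intro k l
    rw [octagonChord, Measure.map_map hg
      ((measurable_segmentMap _ _).prodMk (measurable_segmentMap _ _))]
    exact congrArg (fun φ => unif.map φ) (funext (h k l))
  rw [octagonMeasure, Measure.map_smul, Measure.map_finset_sum hg.aemeasurable]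
  simp_rw [Measure.map_add _ _ hg, hc]
  refine Eq.trans ?_ sum_map_segmentMap_octagonCos
  congr 1
  refine Fintype.sum_equiv (Equiv.addRight j) _ _ fun k => ?_
  simp only [Equiv.coe_addRight, add_right_comm]

lemma diagCoord_octagon {σ : ℝ} {j : Fin 8}
    (h : ∀ k, octagonCos k + σ * octagonCos (k - 2) = √2 * octagonCos (k + j)) (k l : Fin 8)
    (t : ℝ) : diagCoord σ (segmentMap (octagonCos k) (octagonCos l) t,
      segmentMap (octagonCos (k - 2)) (octagonCos (l - 2)) t) =
        segmentMap (octagonCos (k + j)) (octagonCos (l + j)) t := by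
  have hs : √2 ≠ 0 := by positivity
  simp only [diagCoord, segmentMap]
  rw [div_eq_iff hs]
  linear_combination (1 / 2 - t / 2) * h k + (1 / 2 + t / 2) * h l

lemma octagonMeasure_marginals :
    octagonMeasure.map Prod.fst = unif ∧ octagonMeasure.map Prod.snd = unif ∧
    octagonMeasure.map (diagCoord 1) = unif ∧ octagonMeasure.map (diagCoord (-1)) = unif := by
  have hs : √2 * √2 = 2 := Real.mul_self_sqrt zero_le_two
  refine ⟨map_octagonMeasure measurable_fst 0 fun k l t => by simp,
    map_octagonMeasure measurable_snd (-2) fun k l t => by simp [sub_eq_add_neg],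
    map_octagonMeasure (measurable_diagCoord 1) 7 (diagCoord_octagon fun k => ?_),
    map_octagonMeasure (measurable_diagCoord (-1)) 1 (diagCoord_octagon fun k => ?_)⟩
  · fin_cases k <;> simp [octagonCos] <;> linarith
  · fin_cases k <;> simp [octagonCos] <;> linarith

lemma octagonMeasure_ne_archMeasure : octagonMeasure ≠ archMeasure := by
  intro h
  let L : Set (ℝ × ℝ) := {p | p.2 * (√2 / 2 - 1) = √2 / 2 * (p.1 - 1)}
  have hL : MeasurableSet L := measurableSet_eq_fun (by fun_prop) (by fun_prop)
  have hvol : volume L = 0 := by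
    rw [Measure.volume_eq_prod, Measure.measure_prod_null hL]
    refine .of_forall fun x => ?_
    have hne : √2 / 2 - 1 ≠ 0 := (sub_neg.2 sqrt_two_div_two_lt_one).ne
    refine measure_mono_null (t := {√2 / 2 * (x - 1) / (√2 / 2 - 1)}) (fun y hy => ?_)
      (measure_singleton _)
    rw [mem_singleton_iff, eq_div_iff hne]
    exact hy
  have harch : archMeasure L = 0 := withDensity_absolutelyContinuous _ _ hvol
  rw [← h, octagonMeasure, Measure.smul_apply, smul_eq_mul, mul_eq_zero,
    Measure.finsetSum_apply, Finset.sum_eq_zero_iff] at harch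
  have h0 := (harch.resolve_left (by simp)) 0 (Finset.mem_univ _)
  rw [Measure.add_apply, add_eq_zero, octagonChord, Measure.map_apply
    ((measurable_segmentMap _ _).prodMk (measurable_segmentMap _ _)) hL] at h0
  have huniv : (fun t => (segmentMap (octagonCos 0) (octagonCos (0 + 1)) t,
    segmentMap (octagonCos (0 - 2)) (octagonCos (0 + 1 - 2)) t)) ⁻¹' L = univ := by
    refine eq_univ_of_forall fun t => ?_
    simp [L, segmentMap, octagonCos]
    ring
  rw [huniv, measure_univ] at h0
  exact one_ne_zero h0.1

lemma octagonMeasure_isPermuton : IsPermuton octagonMeasure := by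
  obtain ⟨h1, h2, -, -⟩ := octagonMeasure_marginals
  refine ⟨⟨?_⟩, h1, h2⟩
  rw [← measure_univ (μ := unif), ← h1, Measure.map_apply measurable_fst .univ, preimage_univ]

lemma octagonMeasure_W2sqE_add :
    W2sqE idPermuton octagonMeasure + W2sqE octagonMeasure revPermuton = (8 - 4 * √2) / 3 := by
  rw [octagonMeasure_isPermuton.W2sqE_add_eq_iff,
    octagonMeasure_isPermuton.rotation_isPermuton_iff]
  exact octagonMeasure_marginals.2.2

/-- for any permuton P, W₂(id,P)² + W₂(P,rev)² ≥ (8-4√2)/3, with equality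
iff the law of the rotated pair ((X-Y)/√2, (X+Y)/√2) is a permuton; consequently P is a
minimizer iff the rotated pair is a permuton, and the Archimedean measure is not the
unique minimizer. -/
theorem sum_distance_squared_minimizers
    (μ : Measure (ℝ × ℝ)) (h : IsPermuton μ) :
    (8 - 4 * Real.sqrt 2) / 3 ≤ W2sqE idPermuton μ + W2sqE μ revPermuton ∧
    (W2sqE idPermuton μ + W2sqE μ revPermuton = (8 - 4 * Real.sqrt 2) / 3 ↔
      IsPermuton (μ.map fun p =>
        ((p.1 - p.2) / Real.sqrt 2, (p.1 + p.2) / Real.sqrt 2))) ∧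
    ((∀ ν : Measure (ℝ × ℝ), IsPermuton ν →
        W2sqE idPermuton μ + W2sqE μ revPermuton ≤
          W2sqE idPermuton ν + W2sqE ν revPermuton) ↔
      IsPermuton (μ.map fun p =>
        ((p.1 - p.2) / Real.sqrt 2, (p.1 + p.2) / Real.sqrt 2))) ∧
    (∃ ν : Measure (ℝ × ℝ), IsPermuton ν ∧ ν ≠ archMeasure ∧
      ∀ ρ : Measure (ℝ × ℝ), IsPermuton ρ →
        W2sqE idPermuton ν + W2sqE ν revPermuton ≤
          W2sqE idPermuton ρ + W2sqE ρ revPermuton) := by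
  refine ⟨h.le_W2sqE_add, h.W2sqE_add_eq_iff, ?_, octagonMeasure, octagonMeasure_isPermuton,
    octagonMeasure_ne_archMeasure, fun ρ hρ => octagonMeasure_W2sqE_add.trans_le hρ.le_W2sqE_add⟩
  rw [← h.W2sqE_add_eq_iff]
  exact ⟨fun hmin => le_antisymm
      ((hmin _ octagonMeasure_isPermuton).trans_eq octagonMeasure_W2sqE_add) h.le_W2sqE_add,
    fun heq ν hν => heq.trans_le hν.le_W2sqE_add⟩
end

section
/- Let P be a permuton satisfying the plank property. Then there exists a path γ = (γ(t); 0 ≤ t ≤ 1) in the space of permutons with γ(0) = id, γ(1) = P, of finite energy with respect to the 2-Wasserstein metric, whose energy equals the infimum of the energies of all paths in the space of permutons from id to P. -/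
open MeasureTheory Set Filter
open scoped ENNReal Real Topology

/-- The plank of slope θ between levels a and b:
`{(x,y) ∈ [-1,1]² : a ≤ cos(θ+π/2)x + sin(θ+π/2)y ≤ b}`. -/
def plank (θ a b : ℝ) : Set (ℝ × ℝ) :=
  {p | p.1 ∈ Icc (-1 : ℝ) 1 ∧ p.2 ∈ Icc (-1 : ℝ) 1 ∧
    a ≤ Real.cos (θ + π / 2) * p.1 + Real.sin (θ + π / 2) * p.2 ∧
    Real.cos (θ + π / 2) * p.1 + Real.sin (θ + π / 2) * p.2 ≤ b}

/-- The plank property: the mass of every negatively sloped plank (or alternatively of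
every positively sloped plank) is bounded by a constant times its width. -/
def HasPlankProperty (μ : Measure (ℝ × ℝ)) : Prop :=
  (∃ C : ℝ, ∀ θ a b : ℝ, -(π / 2) ≤ θ → θ ≤ 0 → a ≤ b →
      (μ (plank θ a b)).toReal ≤ C * (b - a)) ∨
  (∃ C : ℝ, ∀ θ a b : ℝ, 0 ≤ θ → θ < π / 2 → a ≤ b →
      (μ (plank θ a b)).toReal ≤ C * (b - a))

instance isProbabilityMeasure_unif : IsProbabilityMeasure unif := by
  constructor
  rw [unif, Measure.smul_apply, Measure.restrict_apply_univ, Real.volume_Icc, smul_eq_mul,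
    show (1 - -1 : ℝ) = 2 by norm_num, ENNReal.ofReal_ofNat,
    ENNReal.inv_mul_cancel (by simp) (by simp)]

lemma ae_mem_Icc_unif : ∀ᵐ x ∂unif, x ∈ Icc (-1 : ℝ) 1 :=
  Measure.ae_smul_measure (ae_restrict_mem measurableSet_Icc) _

lemma unif_Iic {a : ℝ} (ha : a ∈ Icc (-1 : ℝ) 1) : unif (Iic a) = ENNReal.ofReal ((a + 1) / 2) := by
  have h : Iic a ∩ Icc (-1 : ℝ) 1 = Icc (-1) a := by
    ext x; simp only [mem_inter_iff, mem_Iic, mem_Icc]; constructor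
    · rintro ⟨h1, h2, h3⟩; exact ⟨h2, h1⟩
    · rintro ⟨h1, h2⟩; exact ⟨h2, h1, h2.trans ha.2⟩
  rw [unif, Measure.smul_apply, Measure.restrict_apply measurableSet_Iic, h, Real.volume_Icc,
    smul_eq_mul, ENNReal.ofReal_div_of_pos two_pos, ENNReal.ofReal_ofNat, sub_neg_eq_add,
    ENNReal.div_eq_inv_mul]

lemma unif_affine_preimage_Icc_le {c k l r : ℝ} (hk : 1 / 2 ≤ k) :
    unif {x | c + k * x ∈ Icc l r} ≤ ENNReal.ofReal (r - l) := by
  have hk0 : 0 < k := by linarith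
  have hsub : {x : ℝ | c + k * x ∈ Icc l r} ⊆ Icc ((l - c) / k) ((r - c) / k) := by
    rintro x ⟨h1, h2⟩
    rw [mem_Icc, div_le_iff₀ hk0, le_div_iff₀ hk0]
    constructor <;> nlinarith
  have hlen : (r - c) / k - (l - c) / k = (r - l) * k⁻¹ := by field_simp; ring
  have hk2 : k⁻¹ ≤ 2 := by
    rw [inv_le_comm₀ hk0 two_pos]; linarith
  calc unif {x | c + k * x ∈ Icc l r}
      ≤ (2 : ℝ≥0∞)⁻¹ * volume (Icc ((l - c) / k) ((r - c) / k)) := by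
        rw [unif, Measure.smul_apply, smul_eq_mul]
        gcongr
        exact Measure.restrict_le_self
    _ ≤ (2 : ℝ≥0∞)⁻¹ * (ENNReal.ofReal (r - l) * 2) := by
        rw [Real.volume_Icc, hlen, ENNReal.ofReal_mul' (by positivity)]
        gcongr
        exact (ENNReal.ofReal_le_ofReal hk2).trans (by simp)
    _ = ENNReal.ofReal (r - l) := by
        rw [mul_comm, mul_assoc, ENNReal.mul_inv_cancel (by simp) (by simp), mul_one]

lemma map_cdf_eq_unif (ν : Measure ℝ) [IsProbabilityMeasure ν]
    (hν : Continuous (ProbabilityTheory.cdf ν)) :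
    ν.map (fun z => 2 * ProbabilityTheory.cdf ν z - 1) = unif := by
  have hmeas : Measurable (fun z => 2 * ProbabilityTheory.cdf ν z - 1) := by fun_prop
  have : IsProbabilityMeasure (ν.map (fun z => 2 * ProbabilityTheory.cdf ν z - 1)) :=
    Measure.isProbabilityMeasure_map hmeas.aemeasurable
  refine Measure.ext_of_Iic _ _ fun a => ?_
  rw [Measure.map_apply hmeas measurableSet_Iic]
  rcases lt_or_ge a (-1) with ha | ha
  · have h1 : (fun z => 2 * ProbabilityTheory.cdf ν z - 1) ⁻¹' Iic a = ∅ := by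
      ext z
      have := ProbabilityTheory.cdf_nonneg ν z
      simp only [mem_preimage, mem_Iic, mem_empty_iff_false, iff_false, not_le]
      linarith
    have h2 : unif (Iic a) = 0 := by
      rw [measure_eq_zero_iff_ae_notMem]
      filter_upwards [ae_mem_Icc_unif] with x hx hxa
      exact absurd (hx.1.trans hxa) (not_le.2 ha)
    rw [h1, h2, measure_empty]
  rcases le_or_gt 1 a with ha1 | ha1
  · have h1 : (fun z => 2 * ProbabilityTheory.cdf ν z - 1) ⁻¹' Iic a = univ := by
      ext z
      have := ProbabilityTheory.cdf_le_one ν z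
      simp only [mem_preimage, mem_Iic, mem_univ, iff_true]
      linarith
    have h2 : unif (Iic a) = 1 := by
      rw [← mem_ae_iff_prob_eq_one measurableSet_Iic]
      filter_upwards [ae_mem_Icc_unif] with x hx
      exact hx.2.trans ha1
    rw [h1, h2, measure_univ]
  rw [unif_Iic ⟨ha, ha1.le⟩]
  set u := (a + 1) / 2 with hu
  have hpre : (fun z => 2 * ProbabilityTheory.cdf ν z - 1) ⁻¹' Iic a =
      {z | ProbabilityTheory.cdf ν z ≤ u} := by
    ext z
    simp only [mem_preimage, mem_Iic, mem_ofPred_eq, hu]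
    constructor <;> intro <;> linarith
  rw [hpre]
  have hu0 : 0 ≤ u := by rw [hu]; linarith
  have hu1 : u < 1 := by rw [hu]; linarith
  rcases eq_empty_or_nonempty {z | ProbabilityTheory.cdf ν z ≤ u} with he | hne
  · have : u ≤ 0 := ge_of_tendsto (ProbabilityTheory.tendsto_cdf_atBot ν)
      (Eventually.of_forall fun z => by
        have : z ∉ {z | ProbabilityTheory.cdf ν z ≤ u} := by simp [he]
        exact (not_le.1 this).le)
    rw [he, measure_empty, ENNReal.ofReal_of_nonpos this]
  obtain ⟨M, hM⟩ := ((ProbabilityTheory.tendsto_cdf_atTop ν).eventually (lt_mem_nhds hu1)).exists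
  have hbdd : BddAbove {z | ProbabilityTheory.cdf ν z ≤ u} := by
    refine ⟨M, fun z hz => ?_⟩
    by_contra! h
    exact absurd ((ProbabilityTheory.monotone_cdf ν h.le).trans hz) (not_le.2 hM)
  have hclosed : IsClosed {z | ProbabilityTheory.cdf ν z ≤ u} := isClosed_le hν continuous_const
  set m := sSup {z | ProbabilityTheory.cdf ν z ≤ u} with hm
  have hmem : ProbabilityTheory.cdf ν m ≤ u := hclosed.csSup_mem hne hbdd
  have hIic : {z | ProbabilityTheory.cdf ν z ≤ u} = Iic m := by
    ext z
    exact ⟨fun hz => le_csSup hbdd hz, fun hz => (ProbabilityTheory.monotone_cdf ν hz).trans hmem⟩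
  have hge : u ≤ ProbabilityTheory.cdf ν m := by
    refine ge_of_tendsto (hν.continuousAt.tendsto.mono_left
      (nhdsWithin_le_nhds : 𝓝[>] m ≤ 𝓝 m)) ?_
    filter_upwards [self_mem_nhdsWithin] with z hz
    have : z ∉ {z | ProbabilityTheory.cdf ν z ≤ u} := by
      simpa [hIic] using hz
    exact (not_le.1 this).le
  rw [hIic, ← ProbabilityTheory.ofReal_cdf, le_antisymm hmem hge]

lemma cdf_unif {x : ℝ} (hx : x ∈ Icc (-1 : ℝ) 1) :
    2 * ProbabilityTheory.cdf unif x - 1 = x := by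
  have h : 0 ≤ (x + 1) / 2 := by linarith [hx.1]
  rw [ProbabilityTheory.cdf_eq_real, Measure.real, unif_Iic hx, ENNReal.toReal_ofReal h]
  ring

/-- Comparison of distribution functions of two nearby random variables, one of which has a
density bounded by one. -/
lemma cdf_map_le_of_ae_abs_sub_le {Ω : Type*} [MeasurableSpace Ω] (μ : Measure Ω)
    [IsProbabilityMeasure μ] {A B : Ω → ℝ} (hA : Measurable A) (hB : Measurable B)
    (hconc : ∀ l r, μ {ω | A ω ∈ Icc l r} ≤ ENNReal.ofReal (r - l)) {δ : ℝ} (hδ : 0 ≤ δ)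
    (hAB : ∀ᵐ ω ∂μ, |A ω - B ω| ≤ δ) (z w : ℝ) :
    ProbabilityTheory.cdf (μ.map A) z ≤ ProbabilityTheory.cdf (μ.map B) w + (|z - w| + δ) := by
  have := Measure.isProbabilityMeasure_map (μ := μ) hA.aemeasurable
  have := Measure.isProbabilityMeasure_map (μ := μ) hB.aemeasurable
  have h0 := ProbabilityTheory.cdf_nonneg (μ.map B) w
  rw [← ENNReal.ofReal_le_ofReal_iff (by positivity), ENNReal.ofReal_add h0 (by positivity),
    ProbabilityTheory.ofReal_cdf, ProbabilityTheory.ofReal_cdf,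
    Measure.map_apply hA measurableSet_Iic, Measure.map_apply hB measurableSet_Iic]
  have hsub : (A ⁻¹' Iic z : Set Ω) ≤ᵐ[μ] (B ⁻¹' Iic w ∪ {ω | A ω ∈ Icc (w - δ) z} : Set Ω) := by
    filter_upwards [hAB] with ω hω hz
    rcases le_or_gt (B ω) w with h | h
    · exact Or.inl h
    · refine Or.inr ⟨?_, hz⟩
      have := (abs_le.1 hω).1
      linarith
  refine (measure_mono_ae hsub).trans ((measure_union_le _ _).trans ?_)
  gcongr
  refine (hconc _ _).trans (ENNReal.ofReal_le_ofReal ?_)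
  linarith [le_abs_self (z - w)]

/-- A piecewise linear interpolation from `ω.1.1` at time `0` through the auxiliary variable `ω.2`
at time `1 / 2` to `ω.1.2` at time `1`. -/
def interp (t : ℝ) (ω : (ℝ × ℝ) × ℝ) : ℝ :=
  max (1 - 2 * t) 0 * ω.1.1 + (1 - |2 * t - 1|) * ω.2 + max (2 * t - 1) 0 * ω.1.2

lemma measurable_interp (t : ℝ) : Measurable (interp t) := by
  unfold interp; fun_prop

lemma ae_mem_Icc_prod_unif {P : Measure (ℝ × ℝ)} (hP : IsPermuton P) :
    ∀ᵐ ω ∂P.prod unif, |ω.1.1| ≤ 1 ∧ |ω.1.2| ≤ 1 ∧ |ω.2| ≤ 1 := by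
  have := hP.1
  have h : ∀ᵐ x ∂unif, |x| ≤ 1 := by
    filter_upwards [ae_mem_Icc_unif] with x hx using abs_le.2 hx
  have h1 : ∀ᵐ p ∂P, |p.1| ≤ 1 := ae_of_ae_map measurable_fst.aemeasurable (hP.2.1 ▸ h)
  have h2 : ∀ᵐ p ∂P, |p.2| ≤ 1 := ae_of_ae_map measurable_snd.aemeasurable (hP.2.2 ▸ h)
  filter_upwards [Measure.quasiMeasurePreserving_fst.ae h1,
    Measure.quasiMeasurePreserving_fst.ae h2,
    Measure.quasiMeasurePreserving_snd.ae h] with ω a b c using ⟨a, b, c⟩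

lemma abs_max_sub_max_zero_le (a b : ℝ) : |max a 0 - max b 0| ≤ |a - b| := by
  simpa using abs_max_sub_max_le_max a 0 b 0

lemma ae_abs_interp_sub_le {P : Measure (ℝ × ℝ)} (hP : IsPermuton P) (s t : ℝ) :
    ∀ᵐ ω ∂P.prod unif, |interp s ω - interp t ω| ≤ 6 * |s - t| := by
  filter_upwards [ae_mem_Icc_prod_unif hP] with ω ⟨hx, hy, hu⟩
  have e1 : |max (1 - 2 * s) 0 - max (1 - 2 * t) 0| ≤ 2 * |s - t| := by
    refine (abs_max_sub_max_zero_le _ _).trans_eq ?_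
    rw [show 1 - 2 * s - (1 - 2 * t) = -2 * (s - t) by ring, abs_mul]; norm_num
  have e2 : |max (2 * s - 1) 0 - max (2 * t - 1) 0| ≤ 2 * |s - t| := by
    refine (abs_max_sub_max_zero_le _ _).trans_eq ?_
    rw [show 2 * s - 1 - (2 * t - 1) = 2 * (s - t) by ring, abs_mul]; norm_num
  have e3 : |(1 - |2 * s - 1|) - (1 - |2 * t - 1|)| ≤ 2 * |s - t| := by
    rw [sub_sub_sub_cancel_left, abs_sub_comm]
    refine (abs_abs_sub_abs_le _ _).trans_eq ?_
    rw [show 2 * s - 1 - (2 * t - 1) = 2 * (s - t) by ring, abs_mul]; norm_num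
  have key : ∀ a x : ℝ, |a| ≤ 2 * |s - t| → |x| ≤ 1 → |a * x| ≤ 2 * |s - t| := by
    intro a x ha hx'
    rw [abs_mul]
    nlinarith [abs_nonneg a, abs_nonneg x]
  have k1 := key _ _ e1 hx
  have k2 := key _ _ e2 hy
  have k3 := key _ _ e3 hu
  have : interp s ω - interp t ω = (max (1 - 2 * s) 0 - max (1 - 2 * t) 0) * ω.1.1 +
      ((1 - |2 * s - 1|) - (1 - |2 * t - 1|)) * ω.2 +
      (max (2 * s - 1) 0 - max (2 * t - 1) 0) * ω.1.2 := by
    unfold interp; ring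
  rw [this]
  refine (abs_add_three _ _ _).trans ?_
  linarith

lemma prod_unif_interp_mem_Icc_le {P : Measure (ℝ × ℝ)} (hP : IsPermuton P)
    (t l r : ℝ) :
    (P.prod unif) {ω | interp t ω ∈ Icc l r} ≤ ENNReal.ofReal (r - l) := by
  have := hP.1
  have hmeas : MeasurableSet {ω | interp t ω ∈ Icc l r} := measurable_interp t measurableSet_Icc
  rcases le_or_gt (1 / 2) (1 - |2 * t - 1|) with hb | hb
  · rw [Measure.prod_apply hmeas]
    refine (lintegral_mono (g := fun _ => ENNReal.ofReal (r - l)) fun p => ?_).trans (by simp)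
    refine le_trans (measure_mono fun u hu => ?_) (unif_affine_preimage_Icc_le
      (c := max (1 - 2 * t) 0 * p.1 + max (2 * t - 1) 0 * p.2) (l := l) (r := r) hb)
    have h : interp t (p, u) ∈ Icc l r := hu
    rw [interp] at h
    rw [mem_ofPred_eq]
    convert h using 1
    ring
  rw [Measure.prod_apply_symm hmeas]
  refine (lintegral_mono (g := fun _ => ENNReal.ofReal (r - l)) fun u => ?_).trans (by simp)
  rcases le_total t (1 / 2) with h2 | h2
  · rw [abs_of_nonpos (by linarith)] at hb
    have hk : 1 / 2 ≤ max (1 - 2 * t) 0 := le_max_of_le_left (by linarith)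
    have hz : max (2 * t - 1) 0 = 0 := max_eq_right (by linarith)
    refine le_trans ?_ (unif_affine_preimage_Icc_le
      (c := (1 - |2 * t - 1|) * u) (l := l) (r := r) hk)
    rw [← hP.2.1]
    refine (measure_mono fun p hp => ?_).trans (Measure.le_map_apply measurable_fst.aemeasurable _)
    have h : interp t (p, u) ∈ Icc l r := hp
    rw [interp, hz] at h
    rw [mem_preimage, mem_ofPred_eq]
    convert h using 1
    ring
  · rw [abs_of_nonneg (by linarith)] at hb
    have hk : 1 / 2 ≤ max (2 * t - 1) 0 := le_max_of_le_left (by linarith)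
    have hz : max (1 - 2 * t) 0 = 0 := max_eq_right (by linarith)
    refine le_trans ?_ (unif_affine_preimage_Icc_le
      (c := (1 - |2 * t - 1|) * u) (l := l) (r := r) hk)
    rw [← hP.2.2]
    refine (measure_mono fun p hp => ?_).trans (Measure.le_map_apply measurable_snd.aemeasurable _)
    have h : interp t (p, u) ∈ Icc l r := hp
    rw [interp, hz] at h
    rw [mem_preimage, mem_ofPred_eq]
    convert h using 1
    ring

/-- The interpolation `interp`, rescaled by its own distribution function so as to be uniformly
distributed on `[-1,1]` at every time. -/
noncomputable def unifInterp (P : Measure (ℝ × ℝ)) (t : ℝ) (ω : (ℝ × ℝ) × ℝ) : ℝ :=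
  2 * ProbabilityTheory.cdf ((P.prod unif).map (interp t)) (interp t ω) - 1

lemma measurable_unifInterp (P : Measure (ℝ × ℝ)) (t : ℝ) : Measurable (unifInterp P t) :=
  (((ProbabilityTheory.monotone_cdf _).measurable.comp (measurable_interp t)).const_mul 2).sub_const
    1

lemma ae_abs_unifInterp_sub_le {P : Measure (ℝ × ℝ)} (hP : IsPermuton P) (s t : ℝ) :
    ∀ᵐ ω ∂P.prod unif, |unifInterp P s ω - unifInterp P t ω| ≤ 24 * |s - t| := by
  have := hP.1
  have hst := ae_abs_interp_sub_le hP s t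
  have hts := ae_abs_interp_sub_le hP t s
  filter_upwards [hst] with ω hω
  have h1 := cdf_map_le_of_ae_abs_sub_le (P.prod unif) (measurable_interp s) (measurable_interp t)
    (prod_unif_interp_mem_Icc_le hP s) (by positivity) hst (interp s ω) (interp t ω)
  have h2 := cdf_map_le_of_ae_abs_sub_le (P.prod unif) (measurable_interp t) (measurable_interp s)
    (prod_unif_interp_mem_Icc_le hP t) (by positivity) hts (interp t ω) (interp s ω)
  rw [abs_sub_comm (interp t ω), abs_sub_comm t] at h2
  rw [abs_le, unifInterp, unifInterp]
  constructor <;> linarith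

lemma map_unifInterp {P : Measure (ℝ × ℝ)} (hP : IsPermuton P) (t : ℝ) :
    (P.prod unif).map (unifInterp P t) = unif := by
  have := hP.1
  have := Measure.isProbabilityMeasure_map (μ := P.prod unif) (measurable_interp t).aemeasurable
  have hcont : Continuous (ProbabilityTheory.cdf ((P.prod unif).map (interp t))) := by
    refine (LipschitzWith.of_le_add fun z w => ?_).continuous
    have := cdf_map_le_of_ae_abs_sub_le (P.prod unif) (measurable_interp t) (measurable_interp t)
      (prod_unif_interp_mem_Icc_le hP t) le_rfl (by simp) z w
    simpa [Real.dist_eq] using this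
  have h := map_cdf_eq_unif _ hcont
  rwa [Measure.map_map (by fun_prop) (measurable_interp t)] at h

/-- A path of permutons which joins the identity permuton to `P` and is Lipschitz for the
Wasserstein metric. Its existence does not rely on the plank property: the auxiliary independent
uniform variable gives the interpolation a bounded density for every permuton `P`. -/
noncomputable def unifPath (P : Measure (ℝ × ℝ)) (t : ℝ) : Measure (ℝ × ℝ) :=
  (P.prod unif).map fun ω => (ω.1.1, unifInterp P t ω)

lemma measurable_unifPath_fun (P : Measure (ℝ × ℝ)) (t : ℝ) :
    Measurable fun ω : (ℝ × ℝ) × ℝ => (ω.1.1, unifInterp P t ω) :=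
  (measurable_fst.comp measurable_fst).prodMk (measurable_unifInterp P t)

lemma map_fst_prod_unif (P : Measure (ℝ × ℝ)) [IsProbabilityMeasure P] :
    (P.prod unif).map Prod.fst = P := by
  simp [Measure.map_fst_prod]

lemma isPermuton_unifPath {P : Measure (ℝ × ℝ)} (hP : IsPermuton P) (t : ℝ) :
    IsPermuton (unifPath P t) := by
  have := hP.1
  refine ⟨Measure.isProbabilityMeasure_map (measurable_unifPath_fun P t).aemeasurable, ?_, ?_⟩
  · rw [unifPath, Measure.map_map measurable_fst (measurable_unifPath_fun P t)]
    change (P.prod unif).map (Prod.fst ∘ Prod.fst) = unif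
    rw [← Measure.map_map measurable_fst measurable_fst, map_fst_prod_unif, hP.2.1]
  · rw [unifPath, Measure.map_map measurable_snd (measurable_unifPath_fun P t)]
    exact map_unifInterp hP t

lemma unifPath_zero {P : Measure (ℝ × ℝ)} (hP : IsPermuton P) : unifPath P 0 = idPermuton := by
  have := hP.1
  have hi : interp 0 = Prod.fst ∘ Prod.fst := by
    ext ω; simp [interp]
  have hlaw : (P.prod unif).map (interp 0) = unif := by
    rw [hi, ← Measure.map_map measurable_fst measurable_fst, map_fst_prod_unif, hP.2.1]
  have hae : (fun ω => (ω.1.1, unifInterp P 0 ω)) =ᵐ[P.prod unif]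
      (fun x : ℝ => (x, x)) ∘ interp 0 := by
    filter_upwards [ae_mem_Icc_prod_unif hP] with ω hω
    simp only [unifInterp, hlaw, Function.comp_apply]
    rw [hi, Function.comp_apply, cdf_unif (abs_le.1 hω.1)]
  rw [unifPath, Measure.map_congr hae, ← Measure.map_map (by fun_prop) (measurable_interp 0), hlaw,
    idPermuton]

lemma unifPath_one {P : Measure (ℝ × ℝ)} (hP : IsPermuton P) : unifPath P 1 = P := by
  have := hP.1
  have hi : interp 1 = Prod.snd ∘ Prod.fst := by
    ext ω; simp [interp]; norm_num
  have hlaw : (P.prod unif).map (interp 1) = unif := by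
    rw [hi, ← Measure.map_map measurable_snd measurable_fst, map_fst_prod_unif, hP.2.2]
  have hae : (fun ω => (ω.1.1, unifInterp P 1 ω)) =ᵐ[P.prod unif] Prod.fst := by
    filter_upwards [ae_mem_Icc_prod_unif hP] with ω hω
    simp only [unifInterp, hlaw]
    rw [hi, Function.comp_apply, cdf_unif (abs_le.1 hω.2.1)]
  rw [unifPath, Measure.map_congr hae, map_fst_prod_unif]

lemma bddBelow_transport_costs (μ ν : Measure (ℝ × ℝ)) :
    BddBelow {e | ∃ m : Measure ((ℝ × ℝ) × (ℝ × ℝ)), IsProbabilityMeasure m ∧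
      m.map Prod.fst = μ ∧ m.map Prod.snd = ν ∧
      e = ∫ p, ((p.1.1 - p.2.1) ^ 2 + (p.1.2 - p.2.2) ^ 2) ∂m} := by
  refine ⟨0, ?_⟩
  rintro e ⟨m, -, -, -, rfl⟩
  exact integral_nonneg fun p => by positivity

lemma W2sqE_unifPath_le {P : Measure (ℝ × ℝ)} (hP : IsPermuton P) (s t : ℝ) :
    W2sqE (unifPath P s) (unifPath P t) ≤ 576 * (s - t) ^ 2 := by
  have := hP.1
  have hms := measurable_unifPath_fun P s
  have hmt := measurable_unifPath_fun P t
  have hm := hms.prodMk hmt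
  refine (csInf_le (bddBelow_transport_costs _ _)
    ⟨(P.prod unif).map fun ω => ((ω.1.1, unifInterp P s ω), (ω.1.1, unifInterp P t ω)),
      Measure.isProbabilityMeasure_map hm.aemeasurable,
      Measure.map_map measurable_fst hm, Measure.map_map measurable_snd hm, rfl⟩).trans ?_
  rw [integral_map hm.aemeasurable (by fun_prop)]
  have hle : (fun ω : (ℝ × ℝ) × ℝ => (ω.1.1 - ω.1.1) ^ 2 +
      (unifInterp P s ω - unifInterp P t ω) ^ 2) ≤ᵐ[P.prod unif]
      fun _ => 576 * (s - t) ^ 2 := by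
    filter_upwards [ae_abs_unifInterp_sub_le hP s t] with ω hω
    have h := pow_le_pow_left₀ (abs_nonneg _) hω 2
    rw [mul_pow, sq_abs, sq_abs] at h
    simp only [sub_self]
    linarith
  refine (integral_mono_of_nonneg (Eventually.of_forall fun ω => by positivity)
    (integrable_const _) hle).trans ?_
  simp

lemma energyOf_unifPath_ne_top {P : Measure (ℝ × ℝ)} (hP : IsPermuton P) :
    energyOf (fun s t => W2sqE (unifPath P s) (unifPath P t)) ≠ ⊤ := by
  refine ne_top_of_le_ne_top (b := ENNReal.ofReal 576) ENNReal.ofReal_ne_top ?_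
  refine iSup_le fun k => iSup_le fun t => iSup_le fun h => ENNReal.ofReal_le_ofReal ?_
  calc ∑ i ∈ Finset.range k, W2sqE (unifPath P (t i)) (unifPath P (t (i + 1))) /
        (t (i + 1) - t i)
      ≤ ∑ i ∈ Finset.range k, 576 * (t (i + 1) - t i) := by
        refine Finset.sum_le_sum fun i hi => ?_
        have hik := Finset.mem_range.1 hi
        have hpos : 0 < t (i + 1) - t i := sub_pos.2 (h.2.2.2 i hik)
        rw [div_le_iff₀ hpos]
        refine (W2sqE_unifPath_le hP _ _).trans_eq ?_
        ring
    _ = 576 := by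
        rw [← Finset.mul_sum, Finset.sum_range_sub, h.2.1, h.2.2.1]; norm_num

/-- The set of permutons, as a subset of the space of probability measures on the plane. -/
def permutonSet : Set (ProbabilityMeasure (ℝ × ℝ)) := {μ | IsPermuton (μ : Measure (ℝ × ℝ))}

/-- The set of couplings of two permutons. -/
def couplingSet : Set (ProbabilityMeasure ((ℝ × ℝ) × (ℝ × ℝ))) :=
  {m | m.map measurable_fst.aemeasurable ∈ permutonSet ∧
    m.map measurable_snd.aemeasurable ∈ permutonSet}

lemma isCompact_setOf_compl_eq_zero {E : Type*} [TopologicalSpace E] [T2Space E] [NormalSpace E]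
    [MeasurableSpace E] [BorelSpace E] {K : Set E} (hK : IsCompact K) :
    IsCompact {μ : ProbabilityMeasure E | (μ : Measure E) Kᶜ = 0} := by
  have := isCompact_setOfPred_probabilityMeasure_mass_eq_compl_isCompact_le (E := E)
    (u := fun _ => 0) (K := fun _ => K) tendsto_const_nhds (fun _ => hK) (Or.inl inferInstance)
  simpa [ProbabilityMeasure.null_iff_toMeasure_null] using this

lemma isClosed_permutonSet : IsClosed permutonSet := by
  let U : ProbabilityMeasure ℝ := ⟨unif, inferInstance⟩
  have h : permutonSet = {μ | μ.map measurable_fst.aemeasurable = U} ∩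
      {μ | μ.map measurable_snd.aemeasurable = U} := by
    ext μ
    exact ⟨fun h => ⟨Subtype.ext h.2.1, Subtype.ext h.2.2⟩,
      fun h => ⟨inferInstance, congrArg Subtype.val h.1, congrArg Subtype.val h.2⟩⟩
  rw [h]
  exact (isClosed_singleton.preimage (ProbabilityMeasure.continuous_map continuous_fst)).inter
    (isClosed_singleton.preimage (ProbabilityMeasure.continuous_map continuous_snd))

lemma IsPermuton.ae_mem {μ : Measure (ℝ × ℝ)} (h : IsPermuton μ) :
    ∀ᵐ p ∂μ, p ∈ Icc (-1 : ℝ) 1 ×ˢ Icc (-1 : ℝ) 1 := by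
  filter_upwards [ae_of_ae_map measurable_fst.aemeasurable (h.2.1 ▸ ae_mem_Icc_unif),
    ae_of_ae_map measurable_snd.aemeasurable (h.2.2 ▸ ae_mem_Icc_unif)] with p h1 h2
    using ⟨h1, h2⟩

lemma isCompact_permutonSet : IsCompact permutonSet :=
  (isCompact_setOf_compl_eq_zero (isCompact_Icc.prod isCompact_Icc)).of_isClosed_subset
    isClosed_permutonSet fun _ hμ => IsPermuton.ae_mem hμ

lemma ae_mem_of_mem_couplingSet {m : ProbabilityMeasure ((ℝ × ℝ) × (ℝ × ℝ))}
    (hm : m ∈ couplingSet) : ∀ᵐ p ∂(m : Measure ((ℝ × ℝ) × (ℝ × ℝ))),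
      p ∈ (Icc (-1 : ℝ) 1 ×ˢ Icc (-1 : ℝ) 1) ×ˢ (Icc (-1 : ℝ) 1 ×ˢ Icc (-1 : ℝ) 1) := by
  filter_upwards [ae_of_ae_map measurable_fst.aemeasurable (IsPermuton.ae_mem hm.1),
    ae_of_ae_map measurable_snd.aemeasurable (IsPermuton.ae_mem hm.2)] with p h1 h2
    using ⟨h1, h2⟩

lemma isCompact_couplingSet : IsCompact couplingSet :=
  (isCompact_setOf_compl_eq_zero ((isCompact_Icc.prod isCompact_Icc).prod
    (isCompact_Icc.prod isCompact_Icc))).of_isClosed_subset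
    ((isClosed_permutonSet.preimage (ProbabilityMeasure.continuous_map continuous_fst)).inter
      (isClosed_permutonSet.preimage (ProbabilityMeasure.continuous_map continuous_snd)))
    fun _ hm => ae_mem_of_mem_couplingSet hm

lemma continuousOn_cost_couplingSet :
    ContinuousOn (fun m : ProbabilityMeasure ((ℝ × ℝ) × (ℝ × ℝ)) =>
      ∫ p, ((p.1.1 - p.2.1) ^ 2 + (p.1.2 - p.2.2) ^ 2) ∂(m : Measure ((ℝ × ℝ) × (ℝ × ℝ))))
      couplingSet := by
  let f : BoundedContinuousFunction ((ℝ × ℝ) × (ℝ × ℝ)) ℝ :=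
    BoundedContinuousFunction.ofNormedAddCommGroup
      (fun p => min ((p.1.1 - p.2.1) ^ 2 + (p.1.2 - p.2.2) ^ 2) 8) (by fun_prop) 8 (fun p => by
        rw [Real.norm_of_nonneg (le_min (by positivity) (by norm_num))]
        exact min_le_right _ _)
  refine (ProbabilityMeasure.continuous_integral_boundedContinuousFunction f).continuousOn.congr
    fun m hm => integral_congr_ae ?_
  filter_upwards [ae_mem_of_mem_couplingSet hm] with p ⟨⟨h1, h2⟩, ⟨h3, h4⟩⟩
  refine (min_eq_left ?_).symm
  have key : ∀ x y : ℝ, x ∈ Icc (-1 : ℝ) 1 → y ∈ Icc (-1 : ℝ) 1 → (x - y) ^ 2 ≤ 4 := by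
    rintro x y ⟨a, b⟩ ⟨c, d⟩
    nlinarith
  linarith [key _ _ h1 h3, key _ _ h2 h4]

/-- The optimal transportation cost between two permutons is attained. -/
lemma exists_optimal_coupling {μ ν : ProbabilityMeasure (ℝ × ℝ)} (hμ : μ ∈ permutonSet)
    (hν : ν ∈ permutonSet) : ∃ m ∈ couplingSet, m.map measurable_fst.aemeasurable = μ ∧
      m.map measurable_snd.aemeasurable = ν ∧
      W2sqE μ ν = ∫ p, ((p.1.1 - p.2.1) ^ 2 + (p.1.2 - p.2.2) ^ 2)
        ∂(m : Measure ((ℝ × ℝ) × (ℝ × ℝ))) := by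
  let S : Set (ProbabilityMeasure ((ℝ × ℝ) × (ℝ × ℝ))) :=
    {m | m.map measurable_fst.aemeasurable = μ} ∩ {m | m.map measurable_snd.aemeasurable = ν}
  have hSclosed : IsClosed S :=
    (isClosed_singleton.preimage (ProbabilityMeasure.continuous_map continuous_fst)).inter
      (isClosed_singleton.preimage (ProbabilityMeasure.continuous_map continuous_snd))
  have hSsub : S ⊆ couplingSet := by
    rintro m ⟨h1, h2⟩
    exact ⟨h1.symm ▸ hμ, h2.symm ▸ hν⟩
  have hSne : S.Nonempty := by
    refine ⟨μ.prod ν, Subtype.ext ?_, Subtype.ext ?_⟩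
    · change ((μ : Measure (ℝ × ℝ)).prod (ν : Measure (ℝ × ℝ))).map Prod.fst = μ
      simp [Measure.map_fst_prod]
    · change ((μ : Measure (ℝ × ℝ)).prod (ν : Measure (ℝ × ℝ))).map Prod.snd = ν
      simp [Measure.map_snd_prod]
  obtain ⟨m, hmS, hmin⟩ := (isCompact_couplingSet.of_isClosed_subset hSclosed hSsub).exists_isMinOn
    hSne (continuousOn_cost_couplingSet.mono hSsub)
  refine ⟨m, hSsub hmS, hmS.1, hmS.2, IsLeast.csInf_eq ⟨?_, ?_⟩⟩
  · exact ⟨m, inferInstance, congrArg Subtype.val hmS.1, congrArg Subtype.val hmS.2, rfl⟩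
  · rintro e ⟨m', hm', h1, h2, rfl⟩
    exact hmin (show (⟨m', hm'⟩ : ProbabilityMeasure _) ∈ S from
      ⟨Subtype.ext h1, Subtype.ext h2⟩)

lemma lowerSemicontinuousOn_W2sqE :
    LowerSemicontinuousOn (fun q : ProbabilityMeasure (ℝ × ℝ) × ProbabilityMeasure (ℝ × ℝ) =>
      W2sqE q.1 q.2) (permutonSet ×ˢ permutonSet) := by
  rw [lowerSemicontinuousOn_iff_preimage_Iic]
  intro y
  let marg : ProbabilityMeasure ((ℝ × ℝ) × (ℝ × ℝ)) →
      ProbabilityMeasure (ℝ × ℝ) × ProbabilityMeasure (ℝ × ℝ) := fun m =>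
    (m.map measurable_fst.aemeasurable, m.map measurable_snd.aemeasurable)
  have hmarg : Continuous marg := (ProbabilityMeasure.continuous_map continuous_fst).prodMk
    (ProbabilityMeasure.continuous_map continuous_snd)
  let T : Set (ProbabilityMeasure ((ℝ × ℝ) × (ℝ × ℝ))) := couplingSet ∩
    (fun m : ProbabilityMeasure ((ℝ × ℝ) × (ℝ × ℝ)) =>
      ∫ p, ((p.1.1 - p.2.1) ^ 2 + (p.1.2 - p.2.2) ^ 2)
        ∂(m : Measure ((ℝ × ℝ) × (ℝ × ℝ)))) ⁻¹' Iic y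
  have hT : IsCompact T := isCompact_couplingSet.of_isClosed_subset
    (continuousOn_cost_couplingSet.preimage_isClosed_of_isClosed isCompact_couplingSet.isClosed
      isClosed_Iic) inter_subset_left
  refine ⟨marg '' T, (hT.image hmarg).isClosed, ?_⟩
  ext q
  refine and_congr_right fun hq => ⟨fun hle => ?_, ?_⟩
  · obtain ⟨m, hm, h1, h2, h3⟩ := exists_optimal_coupling hq.1 hq.2
    exact ⟨m, ⟨hm, h3.ge.trans hle⟩, Prod.ext h1 h2⟩
  · rintro ⟨m, ⟨-, hmy⟩, rfl⟩
    exact (csInf_le (bddBelow_transport_costs _ _) ⟨m, inferInstance, rfl, rfl, rfl⟩).trans hmy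

lemma lowerSemicontinuousOn_energyOf_W2sqE :
    LowerSemicontinuousOn (fun γ : ℝ → ProbabilityMeasure (ℝ × ℝ) =>
      energyOf fun s t => W2sqE (γ s) (γ t)) (univ.pi fun _ => permutonSet) := by
  refine lowerSemicontinuousOn_iSup fun k => lowerSemicontinuousOn_iSup fun t =>
    lowerSemicontinuousOn_iSup fun h => ?_
  refine ENNReal.continuous_ofReal.comp_lowerSemicontinuousOn
    (lowerSemicontinuousOn_sum fun i hi => ?_) ENNReal.ofReal_mono
  have hpos : 0 < t (i + 1) - t i := sub_pos.2 (h.2.2.2 i (Finset.mem_range.1 hi))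
  refine (continuous_id.div_const (t (i + 1) - t i)).comp_lowerSemicontinuousOn
    (f := fun γ : ℝ → ProbabilityMeasure (ℝ × ℝ) => W2sqE (γ (t i)) (γ (t (i + 1)))) ?_
    fun a b hab => div_le_div_of_nonneg_right hab hpos.le
  exact lowerSemicontinuousOn_W2sqE.comp
    (g := fun γ : ℝ → ProbabilityMeasure (ℝ × ℝ) => (γ (t i), γ (t (i + 1))))
    (by fun_prop) fun γ hγ => ⟨hγ _ (mem_univ _), hγ _ (mem_univ _)⟩

lemma energyOf_congr {D D' : ℝ → ℝ → ℝ}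
    (h : ∀ s ∈ Icc (0 : ℝ) 1, ∀ t ∈ Icc (0 : ℝ) 1, D s t = D' s t) : energyOf D = energyOf D' := by
  refine iSup_congr fun k => iSup_congr fun t => iSup_congr fun hp => ?_
  congr 1
  refine Finset.sum_congr rfl fun i hi => ?_
  have hik := Finset.mem_range.1 hi
  rw [h _ (hp.mem_Icc hik.le) _ (hp.mem_Icc hik)]

/-- A path of permutons indexed by `[0,1]`, extended to a path of probability measures indexed by
the real line that is constant on each side of `[0,1]`. -/
noncomputable def extendPath (γ : ℝ → Measure (ℝ × ℝ))
    (hγ : ∀ t ∈ Icc (0 : ℝ) 1, IsPermuton (γ t)) (t : ℝ) : ProbabilityMeasure (ℝ × ℝ) :=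
  ⟨γ (projIcc 0 1 zero_le_one t), (hγ _ (projIcc 0 1 zero_le_one t).2).1⟩

lemma coe_extendPath {γ : ℝ → Measure (ℝ × ℝ)} (hγ : ∀ t ∈ Icc (0 : ℝ) 1, IsPermuton (γ t))
    {t : ℝ} (ht : t ∈ Icc (0 : ℝ) 1) : (extendPath γ hγ t : Measure (ℝ × ℝ)) = γ t := by
  simp [extendPath, projIcc_of_mem zero_le_one ht]

lemma extendPath_mem_permutonSet {γ : ℝ → Measure (ℝ × ℝ)}
    (hγ : ∀ t ∈ Icc (0 : ℝ) 1, IsPermuton (γ t)) (t : ℝ) : extendPath γ hγ t ∈ permutonSet :=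
  hγ _ (projIcc 0 1 zero_le_one t).2

lemma energyOf_extendPath {γ : ℝ → Measure (ℝ × ℝ)}
    (hγ : ∀ t ∈ Icc (0 : ℝ) 1, IsPermuton (γ t)) :
    energyOf (fun s t => W2sqE (extendPath γ hγ s) (extendPath γ hγ t)) =
      energyOf (fun s t => W2sqE (γ s) (γ t)) :=
  energyOf_congr fun s hs t ht => by rw [coe_extendPath hγ hs, coe_extendPath hγ ht]

/-- for a permuton P with the plank property there is a finite-energy
permuton-valued path from the identity permuton to P of minimal energy. -/
theorem minimal_energy_path_exists
    (P : Measure (ℝ × ℝ)) (hP : IsPermuton P) (hplank : HasPlankProperty P) :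
    ∃ γ : ℝ → Measure (ℝ × ℝ),
      (∀ t ∈ Icc (0:ℝ) 1, IsPermuton (γ t)) ∧
      γ 0 = idPermuton ∧ γ 1 = P ∧
      energyOf (fun s t => W2sqE (γ s) (γ t)) ≠ ⊤ ∧
      energyOf (fun s t => W2sqE (γ s) (γ t)) =
        ⨅ (γ' : ℝ → Measure (ℝ × ℝ))
          (_ : (∀ t ∈ Icc (0:ℝ) 1, IsPermuton (γ' t)) ∧ γ' 0 = idPermuton ∧ γ' 1 = P),
          energyOf (fun s t => W2sqE (γ' s) (γ' t)) := by
  have h0 : (0 : ℝ) ∈ Icc (0 : ℝ) 1 := ⟨le_rfl, zero_le_one⟩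
  have h1 : (1 : ℝ) ∈ Icc (0 : ℝ) 1 := ⟨zero_le_one, le_rfl⟩
  have hU : ∀ t ∈ Icc (0 : ℝ) 1, IsPermuton (unifPath P t) := fun t _ => isPermuton_unifPath hP t
  let P₀ : ProbabilityMeasure (ℝ × ℝ) := ⟨idPermuton, unifPath_zero hP ▸ (hU 0 h0).1⟩
  let P₁ : ProbabilityMeasure (ℝ × ℝ) := ⟨P, hP.1⟩
  let S : Set (ℝ → ProbabilityMeasure (ℝ × ℝ)) :=
    (univ.pi fun _ => permutonSet) ∩ ({γ | γ 0 = P₀} ∩ {γ | γ 1 = P₁})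
  have hScompact : IsCompact S := (isCompact_univ_pi fun _ => isCompact_permutonSet).inter_right
    ((isClosed_singleton.preimage (continuous_apply 0)).inter
      (isClosed_singleton.preimage (continuous_apply 1)))
  have hmem : ∀ (γ : ℝ → Measure (ℝ × ℝ)) (hγ : ∀ t ∈ Icc (0 : ℝ) 1, IsPermuton (γ t)),
      γ 0 = idPermuton → γ 1 = P → extendPath γ hγ ∈ S := fun γ hγ hγ0 hγ1 =>
    ⟨fun t _ => extendPath_mem_permutonSet hγ t,
      Subtype.ext ((coe_extendPath hγ h0).trans hγ0),
      Subtype.ext ((coe_extendPath hγ h1).trans hγ1)⟩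
  have hUS := hmem (unifPath P) hU (unifPath_zero hP) (unifPath_one hP)
  obtain ⟨γ, hγS, hγmin⟩ := LowerSemicontinuousOn.exists_isMinOn ⟨_, hUS⟩ hScompact
    (lowerSemicontinuousOn_energyOf_W2sqE.mono inter_subset_left)
  have hmin : ∀ (γ' : ℝ → Measure (ℝ × ℝ)) (hγ' : ∀ t ∈ Icc (0 : ℝ) 1, IsPermuton (γ' t)),
      γ' 0 = idPermuton → γ' 1 = P → energyOf (fun s t => W2sqE (γ s) (γ t)) ≤
        energyOf (fun s t => W2sqE (γ' s) (γ' t)) := fun γ' hγ' hγ0 hγ1 =>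
    (hγmin (hmem γ' hγ' hγ0 hγ1)).trans_eq (energyOf_extendPath hγ')
  have hγperm : ∀ t ∈ Icc (0 : ℝ) 1, IsPermuton (γ t : Measure (ℝ × ℝ)) :=
    fun t _ => hγS.1 t (mem_univ t)
  have hγ0 : (γ 0 : Measure (ℝ × ℝ)) = idPermuton := congrArg Subtype.val hγS.2.1
  have hγ1 : (γ 1 : Measure (ℝ × ℝ)) = P := congrArg Subtype.val hγS.2.2
  refine ⟨fun t => γ t, hγperm, hγ0, hγ1, ?_, le_antisymm ?_ ?_⟩
  · exact ne_top_of_le_ne_top (energyOf_unifPath_ne_top hP)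
      (hmin _ hU (unifPath_zero hP) (unifPath_one hP))
  · exact le_iInf₂ fun γ' h => hmin γ' h.1 h.2.1 h.2.2
  · exact iInf₂_le (fun t => (γ t : Measure (ℝ × ℝ))) ⟨hγperm, hγ0, hγ1⟩
end
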